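/- arXiv:2205.04254 — 2 statements merged into one kernel-verified Lean document; each statement's English description precedes it below -/
import Mathlib

section
/- Let f, g_1, …, g_m ∈ ℝ[x] with g = (g_1,…,g_m), and assume that f is non-negative on S(g). Then there exists q ∈ P(g)[x, λ̄] such that λ_0 · (f − q) vanishes on V(h_FJ). Moreover, if S(g) satisfies the Archimedean condition, one can take q ∈ Q(g)[x, λ̄]. -/
open MvPolynomial

noncomputable section

/-- `p` is a sum of squares of polynomials. -/
def IsSOS {σ : Type*} (p : MvPolynomial σ ℝ) : Prop :=
  ∃ (k : ℕ) (q : Fin k → MvPolynomial σ ℝ), p = ∑ i, q i ^ 2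

/-- Membership in the quadratic module `Q(g)` generated by the tuple `g`. -/
def InQM {σ ι : Type*} [Fintype ι] (g : ι → MvPolynomial σ ℝ) (p : MvPolynomial σ ℝ) : Prop :=
  ∃ (s0 : MvPolynomial σ ℝ) (s : ι → MvPolynomial σ ℝ),
    IsSOS s0 ∧ (∀ j, IsSOS (s j)) ∧ p = s0 + ∑ j, s j * g j

/-- Membership in the preordering `P(g)` generated by the tuple `g`. -/
def InPre {σ ι : Type*} [Fintype ι] [DecidableEq ι] (g : ι → MvPolynomial σ ℝ)
    (p : MvPolynomial σ ℝ) : Prop :=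
  ∃ s : Finset ι → MvPolynomial σ ℝ, (∀ A, IsSOS (s A)) ∧
    p = ∑ A : Finset ι, s A * ∏ j ∈ A, g j

/-- The basic semi-algebraic set `S(g)`. -/
def Sg {n m : ℕ} (g : Fin m → MvPolynomial (Fin n) ℝ) : Set (Fin n → ℝ) :=
  {x | ∀ j, 0 ≤ eval x (g j)}

/-- `S(g)` satisfies the Archimedean condition. -/
def ArchCond {n m : ℕ} (g : Fin m → MvPolynomial (Fin n) ℝ) : Prop :=
  ∃ R : ℝ, 0 < R ∧ InQM g (C R - ∑ i : Fin n, X i ^ 2)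

/-- The real variety `V(h_FJ)` of the Fritz John system attached to `f` and `g`. -/
def VFJ {n m : ℕ} (f : MvPolynomial (Fin n) ℝ) (g : Fin m → MvPolynomial (Fin n) ℝ) :
    Set ((Fin n → ℝ) × (Fin (m + 1) → ℝ)) :=
  {p | (∀ i, p.2 0 * eval p.1 (pderiv i f) = ∑ j, p.2 j.succ * eval p.1 (pderiv i (g j)))
    ∧ (∀ j, p.2 j.succ * eval p.1 (g j) = 0)
    ∧ (∑ j, p.2 j ^ 2 = 1)}

open scoped Polynomial

/-- The intermediate value property for polynomials over a linearly ordered field. -/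
def PolyIVT (R : Type*) [Field R] [LinearOrder R] : Prop :=
  ∀ (p : R[X]) (a b : R), a < b → p.eval a * p.eval b < 0 → ∃ c, a < c ∧ c < b ∧ p.eval c = 0

namespace PolyIVT

section Field

variable {R : Type*} [Field R] [LinearOrder R] [IsStrictOrderedRing R]

theorem mul_pos_of_forall_ne (h : PolyIVT R) {p : R[X]} {x y : R}
    (hp : ∀ w, min x y ≤ w → w ≤ max x y → p.eval w ≠ 0) : 0 < p.eval x * p.eval y := by
  have hx := hp x (min_le_left _ _) (le_max_left _ _)
  have hy := hp y (min_le_right _ _) (le_max_right _ _)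
  by_contra hcon
  have hlt : p.eval x * p.eval y < 0 :=
    lt_of_le_of_ne (not_lt.mp hcon) (mul_ne_zero hx hy)
  rcases lt_trichotomy x y with hxy | hxy | hxy
  · obtain ⟨c, h1, h2, h3⟩ := h p x y hxy hlt
    exact hp c (by simp [hxy.le, h1.le]) (by simp [hxy.le, h2.le]) h3
  · subst hxy
    nlinarith [mul_self_nonneg (p.eval x)]
  · obtain ⟨c, h1, h2, h3⟩ := h p y x hxy (by rwa [mul_comm])
    exact hp c (by simp [hxy.le, h1.le]) (by simp [hxy.le, h2.le]) h3

theorem exists_sq_eq (h : PolyIVT R) {a : R} (ha : 0 ≤ a) : ∃ b, b ^ 2 = a := by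
  rcases ha.eq_or_lt with rfl | ha
  · exact ⟨0, by simp⟩
  obtain ⟨c, -, -, hc⟩ := h (Polynomial.X ^ 2 - Polynomial.C a) 0 (a + 1) (by linarith)
    (by
      have : 0 < a * (a ^ 2 + a + 1) := by positivity
      simp; nlinarith)
  exact ⟨c, by simpa [sub_eq_zero] using hc⟩

/-- Rolle's theorem for polynomials. -/
theorem rolle (h : PolyIVT R) {p : R[X]} (hp : p ≠ 0) {a b : R} (hab : a < b)
    (ha : p.eval a = 0) (hb : p.eval b = 0) :
    ∃ c, a < c ∧ c < b ∧ p.derivative.eval c = 0 := by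
  classical
  -- it suffices to treat consecutive roots
  obtain ⟨b', hb'a, hb'b, hb', hno⟩ : ∃ b', a < b' ∧ b' ≤ b ∧ p.eval b' = 0 ∧
      ∀ w, a < w → w < b' → p.eval w ≠ 0 := by
    have hne : (p.roots.toFinset.filter (a < ·)).Nonempty :=
      ⟨b, by simp [hp, hb, hab]⟩
    obtain ⟨m, hm, hmin⟩ := Finset.exists_minimal hne
    simp only [Finset.mem_filter, Multiset.mem_toFinset, Polynomial.mem_roots hp,
      Polynomial.IsRoot.def] at hm hmin
    refine ⟨m, hm.2, ?_, hm.1, fun w haw hwm hw => ?_⟩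
    · by_contra hcon
      exact hcon (hmin ⟨hb, hab⟩ (not_le.mp hcon).le)
    · exact absurd (hmin ⟨hw, haw⟩ hwm.le) (not_le.mpr hwm)
  suffices ∃ c, a < c ∧ c < b' ∧ p.derivative.eval c = 0 by
    obtain ⟨c, h1, h2, h3⟩ := this
    exact ⟨c, h1, h2.trans_le hb'b, h3⟩
  obtain ⟨q, hq, hqa⟩ := p.exists_eq_pow_rootMultiplicity_mul_and_not_dvd hp a
  set k := p.rootMultiplicity a
  have hk : k ≠ 0 := by
    intro hk
    rw [hk, pow_zero, one_mul] at hq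
    exact hqa (Polynomial.dvd_iff_isRoot.mpr (hq ▸ ha))
  have hq0 : q ≠ 0 := by rintro rfl; simp at hqa
  obtain ⟨r, hr, hrb⟩ := q.exists_eq_pow_rootMultiplicity_mul_and_not_dvd hq0 b'
  set l := q.rootMultiplicity b'
  have hl : l ≠ 0 := by
    intro hl
    rw [hl, pow_zero, one_mul] at hr
    apply hrb
    rw [Polynomial.dvd_iff_isRoot, ← hr]
    rw [hq] at hb'
    simpa [sub_ne_zero.mpr hb'a.ne', hk] using hb'
  rw [Polynomial.dvd_iff_isRoot] at hqa hrb
  have hra : r.eval a ≠ 0 := by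
    intro hra
    apply hqa
    rw [hr]; simp [hra]
  have hrno : ∀ w, min a b' ≤ w → w ≤ max a b' → r.eval w ≠ 0 := by
    intro w h1 h2 hw
    rw [min_eq_left hb'a.le] at h1
    rw [max_eq_right hb'a.le] at h2
    rcases h1.eq_or_lt with rfl | h1
    · exact hra hw
    rcases h2.eq_or_lt with rfl | h2
    · exact hrb hw
    · exact hno w h1 h2 (by rw [hq, hr]; simp [hw])
  have hpos := h.mul_pos_of_forall_ne hrno
  obtain ⟨k, hk'⟩ := Nat.exists_eq_succ_of_ne_zero hk
  obtain ⟨l, hl'⟩ := Nat.exists_eq_succ_of_ne_zero hl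
  set s : R[X] := (Polynomial.C ((k : R) + 1) * (Polynomial.X - Polynomial.C b')
    + Polynomial.C ((l : R) + 1) * (Polynomial.X - Polynomial.C a)) * r
    + (Polynomial.X - Polynomial.C a) * (Polynomial.X - Polynomial.C b') * r.derivative with hs
  have hder : p.derivative = (Polynomial.X - Polynomial.C a) ^ k
      * (Polynomial.X - Polynomial.C b') ^ l * s := by
    rw [hq, hr, hk', hl', hs]
    simp only [Polynomial.derivative_mul, Polynomial.derivative_X_sub_C_pow, Nat.succ_eq_add_one,
      Nat.add_sub_cancel, Nat.cast_add, Nat.cast_one, Polynomial.C_add, Polynomial.C_1,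
      map_natCast]
    ring
  obtain ⟨c, h1, h2, h3⟩ := h s a b' hb'a (by
    have e1 : s.eval a = -(((k : R) + 1) * (b' - a) * r.eval a) := by
      simp [hs]; ring
    have e2 : s.eval b' = ((l : R) + 1) * (b' - a) * r.eval b' := by
      simp [hs]
    rw [e1, e2]
    have : 0 < ((k : R) + 1) * (b' - a) * (((l : R) + 1) * (b' - a)) * (r.eval a * r.eval b') := by
      have := sub_pos.mpr hb'a
      positivity
    nlinarith)
  exact ⟨c, h1, h2, by rw [hder]; simp [h3]⟩

/-- Near a root `y` of `p` in an interval on which `p'` has no root, the sign of `p`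
tells on which side of `y` one is. -/
theorem lt_iff_of_derivative_ne (h : PolyIVT R) {p : R[X]} {u v y : R} (huy : u < y) (hyv : y < v)
    (hp : p.eval y = 0) (hd : ∀ w, u < w → w < v → p.derivative.eval w ≠ 0) {x : R}
    (hux : u ≤ x) (hxv : x ≤ v) :
    (x < y ↔ 0 < p.eval x * p.eval u) ∧ (y < x ↔ p.eval x * p.eval u < 0) := by
  have hp0 : p ≠ 0 := by rintro rfl; exact hd y huy hyv (by simp)
  obtain ⟨r, hr⟩ := Polynomial.dvd_iff_isRoot.mpr hp
  have hdy : p.derivative.eval y = r.eval y := by rw [hr]; simp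
  have hroot : ∀ w, u ≤ w → w ≤ v → p.eval w = 0 → w = y := by
    intro w h1 h2 hw
    by_contra hne
    rcases lt_or_gt_of_ne hne with hlt | hlt
    · obtain ⟨c, h3, h4, h5⟩ := h.rolle hp0 hlt hw hp
      exact hd c (h1.trans_lt h3) (h4.trans hyv) h5
    · obtain ⟨c, h3, h4, h5⟩ := h.rolle hp0 hlt hp hw
      exact hd c (huy.trans h3) (h4.trans_le h2) h5
  have hrne : ∀ w, u ≤ w → w ≤ v → r.eval w ≠ 0 := by
    intro w h1 h2 hw
    have : w = y := hroot w h1 h2 (by rw [hr]; simp [hw])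
    subst this
    exact hd w huy hyv (by rw [hdy, hw])
  have hpos : 0 < r.eval x * r.eval u := h.mul_pos_of_forall_ne fun w h1 h2 =>
    hrne w ((le_min hux le_rfl).trans h1) (h2.trans (max_le hxv (huy.trans hyv).le))
  have e : p.eval x * p.eval u = (y - x) * ((y - u) * (r.eval x * r.eval u)) := by
    rw [hr]; simp; ring
  have hpos2 : 0 < (y - u) * (r.eval x * r.eval u) := mul_pos (sub_pos.mpr huy) hpos
  rw [e]
  constructor
  · rw [mul_pos_iff_of_pos_right hpos2, sub_pos]
  · rw [mul_neg_iff]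
    constructor
    · intro hh; right; exact ⟨by linarith, hpos2⟩
    · rintro (⟨_, h2⟩ | ⟨h1, _⟩)
      · linarith
      · linarith

end Field

end PolyIVT

theorem eval_map_apply {M R : Type*} [Field M] [Field R] (σ : M →+* R) (Q : M[X]) (m : M) :
    (Q.map σ).eval (σ m) = σ (Q.eval m) := by
  rw [Polynomial.eval_map, Polynomial.eval₂_at_apply]

section TwoEmbeddings

variable {M R₁ R₂ : Type*} [Field M] [Field R₁] [LinearOrder R₁] [IsStrictOrderedRing R₁]
  [Field R₂] [LinearOrder R₂] [IsStrictOrderedRing R₂]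

/-- A root of a monic polynomial is bounded by elements of the coefficient field. -/
theorem exists_between_of_root (σ : M →+* R₁) {P : M[X]} (hP : P.Monic) {y : R₁}
    (hy : (P.map σ).eval y = 0) : ∃ u v, σ u < y ∧ y < σ v := by
  classical
  -- `|c| ≤ c ^ 2 + 1`
  set B : M := 1 + ∑ i ∈ Finset.range P.natDegree, (P.coeff i ^ 2 + 1) with hB
  have hB1 : 1 ≤ σ B := by
    rw [hB, map_add, map_one, map_sum]
    have : 0 ≤ ∑ i ∈ Finset.range P.natDegree, σ (P.coeff i ^ 2 + 1) :=
      Finset.sum_nonneg fun i _ => by rw [map_add, map_pow, map_one]; positivity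
    linarith
  suffices |y| < σ (B + 1) by
    refine ⟨-(B + 1), B + 1, ?_, (abs_lt.mp this).2⟩
    rw [map_neg]; exact (abs_lt.mp this).1
  by_contra hcon
  have hcon : σ B + 1 ≤ |y| := by simpa using not_lt.mp hcon
  have h1 : 1 ≤ |y| := by linarith
  have hev : y ^ P.natDegree = -∑ i ∈ Finset.range P.natDegree, σ (P.coeff i) * y ^ i := by
    rw [Polynomial.eval_map, Polynomial.eval₂_eq_sum_range, Finset.sum_range_succ,
      hP.coeff_natDegree, map_one, one_mul] at hy
    linear_combination hy
  rcases Nat.eq_zero_or_pos P.natDegree with h0 | hpos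
  · rw [h0] at hev; simp at hev
  obtain ⟨d, hd⟩ := Nat.exists_eq_succ_of_ne_zero hpos.ne'
  have hle : |y| ^ P.natDegree ≤
      (∑ i ∈ Finset.range P.natDegree, σ (P.coeff i ^ 2 + 1)) * |y| ^ d := by
    rw [← abs_pow, hev, abs_neg, Finset.sum_mul]
    refine (Finset.abs_sum_le_sum_abs _ _).trans (Finset.sum_le_sum fun i hi => ?_)
    rw [abs_mul, abs_pow, map_add, map_pow, map_one]
    have hi' : i ≤ d := by
      have := Finset.mem_range.mp hi; omega
    have hpow : |y| ^ i ≤ |y| ^ d := pow_le_pow_right₀ h1 hi'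
    have hc : |σ (P.coeff i)| ≤ σ (P.coeff i) ^ 2 + 1 := by
      rw [← sq_abs]; nlinarith [sq_nonneg (|σ (P.coeff i)| - 1), abs_nonneg (σ (P.coeff i))]
    exact mul_le_mul hc hpow (by positivity) (by positivity)
  have hSB : (∑ i ∈ Finset.range P.natDegree, σ (P.coeff i ^ 2 + 1)) = σ B - 1 := by
    rw [hB, map_add, map_one, map_sum]; ring
  rw [hSB, hd, pow_succ'] at hle
  have : 0 < |y| ^ d := by positivity
  have := le_of_mul_le_mul_right hle this
  linarith


omit [IsStrictOrderedRing R₁] in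
/-- An interval with end points in `M` around `y` avoiding a given finite subset of `M`. -/
theorem exists_gap (σ : M →+* R₁) (y : R₁) (hy : ∀ m, σ m ≠ y) (Z : Finset R₁)
    (hZ : ∀ r ∈ Z, ∃ m, σ m = r) (hb : ∃ u v, σ u < y ∧ y < σ v) :
    ∃ u v, σ u < y ∧ y < σ v ∧ ∀ r ∈ Z, ¬ (σ u < r ∧ r < σ v) := by
  classical
  induction Z using Finset.induction_on with
  | empty =>
    obtain ⟨u, v, h1, h2⟩ := hb
    exact ⟨u, v, h1, h2, by simp⟩
  | insert r Z _ ih =>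
    obtain ⟨u, v, h1, h2, h3⟩ := ih fun s hs => hZ s (Finset.mem_insert_of_mem hs)
    obtain ⟨m, rfl⟩ := hZ r (Finset.mem_insert_self _ _)
    by_cases hin : σ u < σ m ∧ σ m < σ v
    · rcases lt_or_gt_of_ne (hy m) with hlt | hlt
      · refine ⟨m, v, hlt, h2, fun s hs hs' => ?_⟩
        rcases Finset.mem_insert.mp hs with rfl | hs
        · exact lt_irrefl _ hs'.1
        · exact h3 s hs ⟨hin.1.trans hs'.1, hs'.2⟩
      · refine ⟨u, m, h1, hlt, fun s hs hs' => ?_⟩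
        rcases Finset.mem_insert.mp hs with rfl | hs
        · exact lt_irrefl _ hs'.2
        · exact h3 s hs ⟨hs'.1, hs'.2.trans hin.2⟩
    · refine ⟨u, v, h1, h2, fun s hs hs' => ?_⟩
      rcases Finset.mem_insert.mp hs with rfl | hs
      · exact hin hs'
      · exact h3 s hs hs'


omit [IsStrictOrderedRing R₁] in
theorem exists_gap_of_polynomial (σ : M →+* R₁) (y : R₁) (hy : ∀ m, σ m ≠ y) {Q : M[X]}
    (hQ : Q ≠ 0) (hroots : ∀ x, (Q.map σ).eval x = 0 → ∃ m, σ m = x)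
    (hb : ∃ u v, σ u < y ∧ y < σ v) :
    ∃ u v, σ u < y ∧ y < σ v ∧ ∀ w, σ u < w → w < σ v → (Q.map σ).eval w ≠ 0 := by
  classical
  have hQ' : Q.map σ ≠ 0 := by simpa [Polynomial.map_eq_zero] using hQ
  obtain ⟨u, v, h1, h2, h3⟩ := exists_gap σ y hy (Q.map σ).roots.toFinset (fun r hr => hroots r (by
    simpa [hQ', Polynomial.IsRoot] using hr)) hb
  exact ⟨u, v, h1, h2, fun w hw1 hw2 hw => h3 w (by simpa [hQ', Polynomial.IsRoot] using hw)
    ⟨hw1, hw2⟩⟩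

/-- If all roots of polynomials of degree less than `n` already lie in `M`, then an outer root of
a polynomial of degree `n` in `R₁` has a counterpart in `R₂`. -/
theorem exists_counterpart (h₁ : PolyIVT R₁) (h₂ : PolyIVT R₂) (σ₁ : M →+* R₁) (σ₂ : M →+* R₂)
    (hσ : ∀ m, 0 < σ₁ m ↔ 0 < σ₂ m) {n : ℕ}
    (ih₁ : ∀ Q : M[X], Q ≠ 0 → Q.natDegree < n → ∀ x, (Q.map σ₁).eval x = 0 → ∃ m, σ₁ m = x)
    (ih₂ : ∀ Q : M[X], Q ≠ 0 → Q.natDegree < n → ∀ x, (Q.map σ₂).eval x = 0 → ∃ m, σ₂ m = x)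
    {P : M[X]} (hP : P.Monic) (hn : P.natDegree = n) {y : R₁} (hy : (P.map σ₁).eval y = 0)
    (hyM : ∀ m, σ₁ m ≠ y) :
    ∃ z : R₂, ∀ Q : M[X], 0 < (Q.map σ₁).eval y ↔ 0 < (Q.map σ₂).eval z := by
  classical
  have hchar : CharZero M := (σ₁.charZero_iff σ₁.injective).mpr inferInstance
  have hlt : ∀ {a b : M}, σ₁ a < σ₁ b ↔ σ₂ a < σ₂ b := by
    intro a b
    rw [← sub_pos, ← map_sub, hσ, map_sub, sub_pos]
  have hn0 : n ≠ 0 := by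
    rintro rfl
    rw [Polynomial.eq_one_of_monic_natDegree_zero hP hn] at hy
    simp at hy
  have hneg : ∀ {a : M}, σ₁ a < 0 ↔ σ₂ a < 0 := by
    intro a
    simpa using hlt (a := a) (b := 0)
  have hdne : P.derivative ≠ 0 := by
    intro h0
    exact hn0 (hn ▸ Polynomial.derivative_eq_zero.mp h0)
  have hddeg : P.derivative.natDegree < n := by
    rw [← hn]; exact Polynomial.natDegree_derivative_lt (hn ▸ hn0)
  have hbdd := exists_between_of_root σ₁ hP hy
  obtain ⟨u, v, huy, hyv, hgap⟩ :=
    exists_gap_of_polynomial σ₁ y hyM hdne (ih₁ _ hdne hddeg) hbdd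
  have huv : σ₁ u < σ₁ v := huy.trans hyv
  have hd₁ : ∀ w, σ₁ u < w → w < σ₁ v → (P.map σ₁).derivative.eval w ≠ 0 := by
    rwa [Polynomial.derivative_map]
  have hd₂ : ∀ w, σ₂ u < w → w < σ₂ v → (P.map σ₂).derivative.eval w ≠ 0 := by
    intro w hw1 hw2 hw
    rw [Polynomial.derivative_map] at hw
    obtain ⟨m, rfl⟩ := ih₂ _ hdne hddeg w hw
    rw [eval_map_apply, map_eq_zero] at hw
    exact hgap (σ₁ m) (hlt.mpr hw1) (hlt.mpr hw2) (by rw [eval_map_apply, hw, map_zero])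
  have hchange : (P.map σ₁).eval (σ₁ v) * (P.map σ₁).eval (σ₁ u) < 0 :=
    ((h₁.lt_iff_of_derivative_ne huy hyv hy hd₁ huv.le le_rfl).2).mp hyv
  obtain ⟨z, huz, hzv, hz⟩ := h₂ (P.map σ₂) (σ₂ u) (σ₂ v) (hlt.mp huv) (by
    rw [eval_map_apply, eval_map_apply, ← map_mul] at hchange ⊢
    rw [mul_comm]
    exact hneg.mp hchange)
  have hpos : ∀ m, (σ₁ m < y ↔ σ₂ m < z) ∧ (y < σ₁ m ↔ z < σ₂ m) := by
    intro m
    rcases lt_or_ge (σ₁ m) (σ₁ u) with h | hum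
    · have h' := hlt.mp h
      exact ⟨iff_of_true (h.trans huy) (h'.trans huz),
        iff_of_false (h.trans huy).not_gt (h'.trans huz).not_gt⟩
    rcases lt_or_ge (σ₁ v) (σ₁ m) with h | hmv
    · have h' := hlt.mp h
      exact ⟨iff_of_false (hyv.trans h).not_gt (hzv.trans h').not_gt,
        iff_of_true (hyv.trans h) (hzv.trans h')⟩
    have e₁ := h₁.lt_iff_of_derivative_ne huy hyv hy hd₁ hum hmv
    have e₂ := h₂.lt_iff_of_derivative_ne huz hzv hz hd₂ (x := σ₂ m)
      (not_lt.mp fun h => hum.not_gt (hlt.mpr h)) (not_lt.mp fun h => hmv.not_gt (hlt.mpr h))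
    rw [eval_map_apply, eval_map_apply, ← map_mul] at e₁ e₂
    exact ⟨by rw [e₁.1, e₂.1, hσ], by rw [e₁.2, e₂.2, hneg]⟩
  have hzM : ∀ m, σ₂ m ≠ z := by
    intro m hm
    rcases lt_or_gt_of_ne (hyM m) with h | h
    · exact ((hpos m).1.mp h).ne hm
    · exact ((hpos m).2.mp h).ne' hm
  refine ⟨z, fun Q => ?_⟩
  -- reduce to small degree
  have hmod₁ : (Q.map σ₁).eval y = ((Q %ₘ P).map σ₁).eval y := by
    conv_lhs => rw [← Polynomial.modByMonic_add_div Q P]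
    simp [hy]
  have hmod₂ : (Q.map σ₂).eval z = ((Q %ₘ P).map σ₂).eval z := by
    conv_lhs => rw [← Polynomial.modByMonic_add_div Q P]
    simp [hz]
  rw [hmod₁, hmod₂]
  have hPne : P ≠ 1 := by
    rintro rfl
    simp at hn
    exact hn0 hn.symm
  have hdeg : (Q %ₘ P).natDegree < n := hn ▸ Polynomial.natDegree_modByMonic_lt Q hP hPne
  generalize Q %ₘ P = S at hdeg
  rcases eq_or_ne S 0 with rfl | hS
  · simp
  obtain ⟨a, b, hay, hyb, hno⟩ := exists_gap_of_polynomial σ₁ y hyM hS (ih₁ S hS hdeg) hbdd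
  have hab : σ₁ a < σ₁ b := hay.trans hyb
  obtain ⟨m, ham, hmb⟩ : ∃ m, σ₁ a < σ₁ m ∧ σ₁ m < σ₁ b := by
    refine ⟨(a + b) / 2, ?_, ?_⟩ <;> rw [map_div₀, map_add, map_ofNat] <;> linarith
  have hS₁ : 0 < (S.map σ₁).eval y * (S.map σ₁).eval (σ₁ m) :=
    h₁.mul_pos_of_forall_ne fun w hw1 hw2 =>
      hno w ((lt_min hay ham).trans_le hw1) (hw2.trans_lt (max_lt hyb hmb))
  have hS₂ : 0 < (S.map σ₂).eval z * (S.map σ₂).eval (σ₂ m) := by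
    refine h₂.mul_pos_of_forall_ne fun w hw1 hw2 hw => ?_
    obtain ⟨k, rfl⟩ := ih₂ S hS hdeg w hw
    rw [eval_map_apply, map_eq_zero] at hw
    refine hno (σ₁ k) (hlt.mpr (lt_of_lt_of_le (lt_min ?_ (hlt.mp ham)) hw1))
      (hlt.mpr (lt_of_le_of_lt hw2 (max_lt ?_ (hlt.mp hmb)))) (by
        rw [eval_map_apply, hw, map_zero])
    · exact (hpos a).1.mp hay
    · exact (hpos b).2.mp hyb
  rw [pos_iff_pos_of_mul_pos hS₁, pos_iff_pos_of_mul_pos hS₂, eval_map_apply, eval_map_apply, hσ]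

end TwoEmbeddings

section Maximal

variable {R₁ R₂ : Type*} [Field R₁] [LinearOrder R₁] [IsStrictOrderedRing R₁]
  [Field R₂] [LinearOrder R₂] [IsStrictOrderedRing R₂]

/-- A subring of `R₁ × R₂` whose elements have components of the same sign; it is the graph of
an order isomorphism between subrings of `R₁` and `R₂`. -/
def SignCompatible (Γ : Subring (R₁ × R₂)) : Prop := ∀ p ∈ Γ, 0 < p.1 ↔ 0 < p.2

theorem SignCompatible.eq_zero_iff {Γ : Subring (R₁ × R₂)} (h : SignCompatible Γ) {p : R₁ × R₂}
    (hp : p ∈ Γ) : p.1 = 0 ↔ p.2 = 0 := by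
  have h1 := h p hp
  have h2 := h (-p) (neg_mem hp)
  simp only [Prod.fst_neg, Prod.snd_neg, neg_pos] at h2
  constructor
  · intro h0
    rw [h0] at h1 h2
    exact le_antisymm (not_lt.mp fun h => lt_irrefl _ (h1.mpr h))
      (not_lt.mp fun h => lt_irrefl _ (h2.mpr h))
  · intro h0
    rw [h0] at h1 h2
    exact le_antisymm (not_lt.mp fun h => lt_irrefl _ (h1.mp h))
      (not_lt.mp fun h => lt_irrefl _ (h2.mp h))

omit [IsStrictOrderedRing R₁] [IsStrictOrderedRing R₂] in
theorem exists_maximal_signCompatible (Γ₀ : Subring (R₁ × R₂)) (h₀ : SignCompatible Γ₀) :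
    ∃ Γ, Γ₀ ≤ Γ ∧ Maximal SignCompatible Γ := by
  refine zorn_le_nonempty₀ {Γ : Subring (R₁ × R₂) | SignCompatible Γ} ?_ Γ₀ h₀
  intro c hc hchain Γ hΓ
  refine ⟨sSup c, ?_, fun _ h => le_sSup h⟩
  intro p hp
  rw [Subring.mem_sSup_of_directedOn ⟨Γ, hΓ⟩ hchain.directedOn] at hp
  obtain ⟨Δ, hΔ, hp⟩ := hp
  exact hc hΔ p hp

variable {Γ : Subring (R₁ × R₂)}

/-- First projection. -/
def projFst (Γ : Subring (R₁ × R₂)) : Γ →+* R₁ := (RingHom.fst R₁ R₂).comp Γ.subtype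

/-- Second projection. -/
def projSnd (Γ : Subring (R₁ × R₂)) : Γ →+* R₂ := (RingHom.snd R₁ R₂).comp Γ.subtype

omit [IsStrictOrderedRing R₁] [IsStrictOrderedRing R₂] in
theorem mem_of_maximal_signCompatible (hΓ : Maximal SignCompatible Γ) {y : R₁} {z : R₂}
    (h : ∀ Q : Γ[X], 0 < Q.eval₂ (projFst Γ) y ↔ 0 < Q.eval₂ (projSnd Γ) z) : (y, z) ∈ Γ := by
  set φ := Polynomial.eval₂RingHom Γ.subtype (y, z)
  have hle : Γ ≤ φ.range := fun p hp => ⟨Polynomial.C ⟨p, hp⟩, by simp [φ]⟩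
  refine hΓ.le_of_ge ?_ hle ⟨Polynomial.X, by simp [φ]⟩
  rintro _ ⟨Q, rfl⟩
  have e1 : (φ Q).1 = Q.eval₂ (projFst Γ) y := Polynomial.hom_eval₂ Q _ (RingHom.fst R₁ R₂) _
  have e2 : (φ Q).2 = Q.eval₂ (projSnd Γ) z := Polynomial.hom_eval₂ Q _ (RingHom.snd R₁ R₂) _
  rw [e1, e2]
  exact h Q

theorem inv_mem_of_maximal_signCompatible (hΓ : Maximal SignCompatible Γ) {y : R₁} {z : R₂}
    (h : (y, z) ∈ Γ) (hy : y ≠ 0) : (y⁻¹, z⁻¹) ∈ Γ := by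
  have hz : z ≠ 0 := fun hz => hy ((hΓ.prop.eq_zero_iff h).mpr hz)
  refine mem_of_maximal_signCompatible hΓ fun Q => ?_
  set N := 2 * Q.natDegree with hN
  have hle : Q.natDegree ≤ N := by omega
  set g : Γ := ⟨(y, z), h⟩
  let _ : Invertible y⁻¹ := ⟨y, mul_inv_cancel₀ hy, inv_mul_cancel₀ hy⟩
  let _ : Invertible z⁻¹ := ⟨z, mul_inv_cancel₀ hz, inv_mul_cancel₀ hz⟩
  have e1 := Polynomial.eval₂_reflect_mul_pow (projFst Γ) y⁻¹ N Q hle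
  have e2 := Polynomial.eval₂_reflect_mul_pow (projSnd Γ) z⁻¹ N Q hle
  have f1 : Polynomial.eval₂ (projFst Γ) (⅟(y⁻¹)) (Polynomial.reflect N Q)
      = projFst Γ ((Polynomial.reflect N Q).eval g) :=
    Polynomial.eval₂_at_apply (p := Polynomial.reflect N Q) (projFst Γ) g
  have f2 : Polynomial.eval₂ (projSnd Γ) (⅟(z⁻¹)) (Polynomial.reflect N Q)
      = projSnd Γ ((Polynomial.reflect N Q).eval g) :=
    Polynomial.eval₂_at_apply (p := Polynomial.reflect N Q) (projSnd Γ) g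
  have p1 : 0 < (y⁻¹) ^ N := by rw [hN, pow_mul]; positivity
  have p2 : 0 < (z⁻¹) ^ N := by rw [hN, pow_mul]; positivity
  rw [← e1, ← e2, f1, f2, mul_pos_iff_of_pos_right p1, mul_pos_iff_of_pos_right p2]
  exact hΓ.prop _ ((Polynomial.reflect N Q).eval g).2

theorem isField_of_maximal_signCompatible (hΓ : Maximal SignCompatible Γ) : IsField Γ where
  exists_pair_ne := ⟨0, 1, zero_ne_one⟩
  mul_comm := mul_comm
  mul_inv_cancel := by
    rintro ⟨⟨y, z⟩, h⟩ hne
    have hy : y ≠ 0 := by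
      intro hy
      apply hne
      have hz : z = 0 := (hΓ.prop.eq_zero_iff h).mp hy
      subst hy; subst hz; rfl
    have hz : z ≠ 0 := fun hz => hy ((hΓ.prop.eq_zero_iff h).mpr hz)
    refine ⟨⟨_, inv_mem_of_maximal_signCompatible hΓ h hy⟩, ?_⟩
    ext <;> simp [hy, hz]

/-- The components of a maximal sign-compatible subring are relatively algebraically closed. -/
theorem exists_mem_of_maximal_signCompatible (h₁ : PolyIVT R₁) (h₂ : PolyIVT R₂)
    (hΓ : Maximal SignCompatible Γ) (Q : Γ[X]) (hQ : Q ≠ 0) :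
    (∀ y, Q.eval₂ (projFst Γ) y = 0 → ∃ m, projFst Γ m = y) ∧
    (∀ z, Q.eval₂ (projSnd Γ) z = 0 → ∃ m, projSnd Γ m = z) := by
  let _ : Field Γ := (isField_of_maximal_signCompatible hΓ).toField
  induction hn : Q.natDegree using Nat.strong_induction_on generalizing Q with
  | _ n ih =>
  have hσ : ∀ m : Γ, 0 < projFst Γ m ↔ 0 < projSnd Γ m := fun m => hΓ.prop _ m.2
  set P : Γ[X] := Q * Polynomial.C Q.leadingCoeff⁻¹ with hP
  have hmonic : P.Monic := Polynomial.monic_mul_leadingCoeff_inv hQ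
  have hdeg : P.natDegree = n := by
    rw [hP, Polynomial.natDegree_mul_leadingCoeff_inv Q hQ, hn]
  have ih₁ : ∀ Q : Γ[X], Q ≠ 0 → Q.natDegree < n → ∀ x, (Q.map (projFst Γ)).eval x = 0 →
      ∃ m, projFst Γ m = x := fun Q hQ hd x hx =>
    (ih _ hd Q hQ rfl).1 x (by rwa [← Polynomial.eval_map])
  have ih₂ : ∀ Q : Γ[X], Q ≠ 0 → Q.natDegree < n → ∀ x, (Q.map (projSnd Γ)).eval x = 0 →
      ∃ m, projSnd Γ m = x := fun Q hQ hd x hx =>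
    (ih _ hd Q hQ rfl).2 x (by rwa [← Polynomial.eval_map])
  constructor
  · intro y hy
    by_contra! hcon
    obtain ⟨z, hz⟩ := exists_counterpart h₁ h₂ (projFst Γ) (projSnd Γ) hσ ih₁ ih₂ hmonic hdeg
      (y := y) (by rw [hP, Polynomial.eval_map, Polynomial.eval₂_mul, hy, zero_mul]) hcon
    simp only [Polynomial.eval_map] at hz
    exact hcon ⟨_, mem_of_maximal_signCompatible hΓ hz⟩ rfl
  · intro z hz
    by_contra! hcon
    obtain ⟨y, hy⟩ := exists_counterpart h₂ h₁ (projSnd Γ) (projFst Γ) (fun m => (hσ m).symm)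
      ih₂ ih₁ hmonic hdeg (y := z)
      (by rw [hP, Polynomial.eval_map, Polynomial.eval₂_mul, hz, zero_mul]) hcon
    simp only [Polynomial.eval_map] at hy
    exact hcon ⟨_, mem_of_maximal_signCompatible hΓ fun Q => (hy Q).symm⟩ rfl

end Maximal

section Germ

variable {ι F : Type*} [Field F] [LinearOrder F] [IsStrictOrderedRing F] {U : Ultrafilter ι}

open Filter

omit [IsStrictOrderedRing F] in
theorem PolyIVT.germ (hF : PolyIVT F) : PolyIVT (Germ (U : Filter ι) F) := by
  intro p a b hab hp
  induction a using Germ.inductionOn with | _ a => ?_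
  induction b using Germ.inductionOn with | _ b => ?_
  set κ := Germ.coeRingHom (R := F) (U : Filter ι)
  obtain ⟨P, rfl⟩ := Polynomial.map_surjective κ
    (fun g => g.inductionOn fun f => ⟨f, rfl⟩) p
  have key : ∀ c : ι → F, (P.map κ).eval (c : Germ (U : Filter ι) F) =
      ((fun i => (P.map (Pi.evalRingHom (fun _ => F) i)).eval (c i) : ι → F) :
        Germ (U : Filter ι) F) := by
    intro c
    have h1 : (P.map κ).eval (κ c) = κ (P.eval c) := by
      rw [Polynomial.eval_map, Polynomial.eval₂_at_apply]
    refine h1.trans (congrArg (fun f : ι → F => (f : Germ (U : Filter ι) F)) ?_)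
    funext i
    rw [Polynomial.eval_map]
    exact (Polynomial.eval₂_at_apply (Pi.evalRingHom (fun _ => F) i) c).symm
  rw [key, key, ← Germ.coe_mul, ← Germ.coe_zero, Germ.coe_lt] at hp
  rw [Germ.coe_lt] at hab
  have : ∀ i, ∃ c, (a i < b i ∧ (P.map (Pi.evalRingHom (fun _ => F) i)).eval (a i) *
      (P.map (Pi.evalRingHom (fun _ => F) i)).eval (b i) < 0) →
      (a i < c ∧ c < b i ∧ (P.map (Pi.evalRingHom (fun _ => F) i)).eval c = 0) := by
    intro i
    by_cases h : a i < b i ∧ (P.map (Pi.evalRingHom (fun _ => F) i)).eval (a i) *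
      (P.map (Pi.evalRingHom (fun _ => F) i)).eval (b i) < 0
    · obtain ⟨c, hc⟩ := hF _ _ _ h.1 h.2
      exact ⟨c, fun _ => hc⟩
    · exact ⟨0, fun h' => absurd h' h⟩
  choose c hc using this
  refine ⟨(c : Germ (U : Filter ι) F), ?_, ?_, ?_⟩
  · rw [Germ.coe_lt]
    filter_upwards [hab, hp] with i h1 h2 using (hc i ⟨h1, h2⟩).1
  · rw [Germ.coe_lt]
    filter_upwards [hab, hp] with i h1 h2 using (hc i ⟨h1, h2⟩).2.1
  · rw [key, ← Germ.coe_zero, Germ.coe_eq]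
    filter_upwards [hab, hp] with i h1 h2 using (hc i ⟨h1, h2⟩).2.2

omit [LinearOrder F] [IsStrictOrderedRing F] in
theorem germ_eval₂ {σ S : Type*} [CommRing S] (c : S →+* F) (b : σ → ι → F)
    (h : MvPolynomial σ S) :
    h.eval₂ ((Germ.coeRingHom (U : Filter ι)).comp (RingHom.pi fun _ => c))
      (fun i => (b i : Germ (U : Filter ι) F)) =
      ((fun k => h.eval₂ c fun i => b i k : ι → F) : Germ (U : Filter ι) F) := by
  have h1 := MvPolynomial.eval₂_comp_left (Germ.coeRingHom (R := F) (U : Filter ι))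
    (RingHom.pi fun _ => c) b h
  refine h1.symm.trans (congrArg (fun f : ι → F => (f : Germ (U : Filter ι) F)) ?_)
  funext k
  exact MvPolynomial.eval₂_comp_left (Pi.evalRingHom (fun _ => F) k)
    (RingHom.pi fun _ => c) b h

end Germ

section RealPoints

open Filter

/-- Real polynomial equations solvable in `A` are solvable in `ℝ`. -/
def HasRealPoints (A : Type*) [CommRing A] [Algebra ℝ A] : Prop :=
  ∀ (σ : Type) (h : MvPolynomial σ ℝ) (y : σ → A), aeval y h = 0 → ∃ x : σ → ℝ, eval x h = 0

variable {R : Type*} [Field R] [LinearOrder R] [IsStrictOrderedRing R] [Algebra ℝ R]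

omit [LinearOrder R] [IsStrictOrderedRing R] in
theorem hasRealPoints_bot : HasRealPoints (⊥ : IntermediateField ℝ R) := by
  intro σ h y hy
  set e := IntermediateField.botEquiv ℝ R
  refine ⟨fun i => e (y i), ?_⟩
  have := congrArg e hy
  rw [map_zero, ← AlgEquiv.coe_toAlgHom, MvPolynomial.comp_aeval_apply] at this
  rw [← this, MvPolynomial.aeval_def, Algebra.algebraMap_self]
  rfl

theorem mem_bot_of_isAlgebraic_real (y : R) (hy : IsAlgebraic (⊥ : IntermediateField ℝ R) y) :
    y ∈ (⊥ : IntermediateField ℝ R) := by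
  have hy' : IsAlgebraic ℝ y := hy.restrictScalars ℝ
  have : Algebra.IsAlgebraic ℝ (IntermediateField.adjoin ℝ {y}) :=
    IntermediateField.isAlgebraic_adjoin_simple hy'.isIntegral
  rcases Real.nonempty_algEquiv_or (IntermediateField.adjoin ℝ {y}) with ⟨⟨e⟩⟩ | ⟨⟨e⟩⟩
  · rw [IntermediateField.mem_bot]
    set y' : IntermediateField.adjoin ℝ {y} := ⟨y, IntermediateField.mem_adjoin_simple_self ℝ y⟩
    refine ⟨e y', ?_⟩
    have : algebraMap ℝ (IntermediateField.adjoin ℝ {y}) (e y') = y' := by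
      apply e.injective
      rw [e.commutes]; rfl
    exact congrArg Subtype.val this
  · exfalso
    have h1 : (e.symm Complex.I) ^ 2 = -1 := by
      rw [← map_pow, Complex.I_sq, map_neg, map_one]
    have h2 := congrArg (Subtype.val) h1
    have h3 : ((e.symm Complex.I : IntermediateField.adjoin ℝ {y}) : R) ^ 2 = -1 := by
      simpa using h2
    nlinarith [sq_nonneg ((e.symm Complex.I : IntermediateField.adjoin ℝ {y}) : R)]

omit [IsStrictOrderedRing R] in
theorem PolyIVT.intermediateField (hR : PolyIVT R) (F : IntermediateField ℝ R)
    (hF : ∀ y : R, IsAlgebraic F y → y ∈ F) : PolyIVT F := by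
  intro p a b hab hp
  have key : ∀ c : F, Polynomial.eval (c : R) (p.map (algebraMap F R)) = (p.eval c : F) := by
    intro c
    rw [Polynomial.eval_map]
    exact Polynomial.eval₂_at_apply (algebraMap F R) c
  obtain ⟨c, h1, h2, h3⟩ := hR (p.map (algebraMap F R)) a b hab (by
    rw [key, key]; exact_mod_cast hp)
  have hp0 : p ≠ 0 := by rintro rfl; simp at hp
  have hc : c ∈ F := hF c ⟨p, hp0, by rwa [Polynomial.aeval_def, ← Polynomial.eval_map]⟩
  refine ⟨⟨c, hc⟩, h1, h2, ?_⟩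
  have := key ⟨c, hc⟩
  rw [h3] at this
  exact_mod_cast this.symm

/-- An element of `F` in the same gap of `Z` as `t`. -/
theorem exists_same_gap {F : IntermediateField ℝ R} (t : R) (Z : Finset F) :
    ∃ a : F, ∀ r ∈ Z, ((r : R) < t → (r : R) < a) ∧ (t < r → (a : R) < r) := by
  obtain ⟨a, h1, h2⟩ := Order.exists_between_finsets (Z.filter fun r : F => (r : R) < t)
    (Z.filter fun r : F => t < (r : R)) (by
      intro x hx y hy
      rw [Finset.mem_filter] at hx hy
      exact hx.2.trans hy.2)
  refine ⟨a, fun r hr => ⟨fun h => h1 r (Finset.mem_filter.mpr ⟨hr, h⟩), fun h =>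
    h2 r (Finset.mem_filter.mpr ⟨hr, h⟩)⟩⟩

theorem exists_intermediateField_mem_hasRealPoints (hR : PolyIVT R) (F : IntermediateField ℝ R)
    (hF : ∀ y : R, IsAlgebraic F y → y ∈ F) (hF' : HasRealPoints F) (t : R) :
    ∃ E : IntermediateField ℝ R, F ≤ E ∧ t ∈ E ∧ (∀ y : R, IsAlgebraic E y → y ∈ E) ∧
      HasRealPoints E := by
  classical
  by_cases ht : t ∈ F
  · exact ⟨F, le_rfl, ht, hF, hF'⟩
  choose a ha using fun Z => exists_same_gap (F := F) t Z
  set U : Ultrafilter (Finset F) := Ultrafilter.of atTop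
  let G := Germ (U : Filter (Finset F)) F
  have hFI : PolyIVT F := hR.intermediateField F hF
  have hG : PolyIVT G := hFI.germ
  let κ : (Finset F → F) →+* G := Germ.coeRingHom (U : Filter (Finset F))
  let cst : F →+* G := κ.comp (RingHom.pi fun _ => RingHom.id F)
  let φ : F[X] →+* R × G :=
    (Polynomial.eval₂RingHom (algebraMap F R) t).prod (Polynomial.eval₂RingHom cst (κ a))
  have hφ2 : ∀ q, (φ q).2 = κ fun Z => q.eval (a Z) := by
    intro q
    change Polynomial.eval₂ cst (κ a) q = _
    rw [← Polynomial.hom_eval₂]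
    congr 1
    funext Z
    change Pi.evalRingHom (fun _ => F) Z _ = _
    rw [Polynomial.hom_eval₂]
    rfl
  have h₀ : SignCompatible φ.range := by
    rintro _ ⟨q, rfl⟩
    rw [hφ2]
    change 0 < Polynomial.eval₂ (algebraMap F R) t q ↔
      ((0 : Finset F → F) : G) < ((fun Z => q.eval (a Z) : Finset F → F) : G)
    rw [Germ.coe_lt]
    by_cases hq : q = 0
    · simp [hq, U.neBot.ne]
    rw [← eventually_const (f := (U : Filter (Finset F)))
      (p := 0 < Polynomial.eval₂ (algebraMap F R) t q)]
    apply eventually_congr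
    have hle : (U : Filter (Finset F)) ≤ atTop := Ultrafilter.of_le _
    filter_upwards [hle (mem_atTop q.roots.toFinset)] with Z hZ
    have hq' : q.map (algebraMap F R) ≠ 0 :=
      (Polynomial.map_ne_zero_iff (algebraMap F R).injective).mpr hq
    have hpos := hR.mul_pos_of_forall_ne (p := q.map (algebraMap F R)) (x := t) (y := a Z) (by
      intro w hw1 hw2 hw0
      have hwF : w ∈ F := hF w ⟨q, hq, by rwa [Polynomial.aeval_def, ← Polynomial.eval_map]⟩
      have hwZ : (⟨w, hwF⟩ : F) ∈ Z := by
        apply hZ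
        rw [Multiset.mem_toFinset, Polynomial.mem_roots hq]
        have := Polynomial.eval₂_at_apply (p := q) (algebraMap F R) ⟨w, hwF⟩
        rw [← Polynomial.eval_map] at this
        rw [Polynomial.IsRoot]
        apply (algebraMap F R).injective
        rw [← this, map_zero]
        exact hw0
      have h := ha Z _ hwZ
      rcases lt_trichotomy w t with h1 | h1 | h1
      · rcases min_le_iff.mp hw1 with h2 | h2
        · exact absurd h1 (not_lt.mpr h2)
        · exact absurd (h.1 h1) (not_lt.mpr h2)
      · exact ht (h1 ▸ hwF)
      · rcases le_max_iff.mp hw2 with h2 | h2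
        · exact absurd h1 (not_lt.mpr h2)
        · exact absurd (h.2 h1) (not_lt.mpr h2))
    have e : (q.map (algebraMap F R)).eval ((a Z : F) : R) = ((q.eval (a Z) : F) : R) := by
      rw [Polynomial.eval_map]
      exact Polynomial.eval₂_at_apply (algebraMap F R) (a Z)
    rw [e, Polynomial.eval_map] at hpos
    change _ ↔ (0 : R) < ((q.eval (a Z) : F) : R)
    rcases mul_pos_iff.mp hpos with ⟨h1, h2⟩ | ⟨h1, h2⟩
    · exact ⟨fun _ => h2, fun _ => h1⟩
    · exact ⟨fun h => absurd h (not_lt.mpr h1.le), fun h => absurd h (not_lt.mpr h2.le)⟩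
  obtain ⟨Γ, hΓ₀, hΓ⟩ := exists_maximal_signCompatible _ h₀
  have hFΓ : ∀ c : F, ((c : R), cst c) ∈ Γ := fun c =>
    hΓ₀ ⟨Polynomial.C c, Prod.ext (Polynomial.eval₂_C _ _) (Polynomial.eval₂_C _ _)⟩
  have htΓ : (t, κ a) ∈ Γ :=
    hΓ₀ ⟨Polynomial.X, Prod.ext (Polynomial.eval₂_X _ _) (Polynomial.eval₂_X _ _)⟩
  let E : IntermediateField ℝ R :=
    { Γ.map (RingHom.fst R G) with
      algebraMap_mem' := fun r => ⟨_, hFΓ (algebraMap ℝ F r), rfl⟩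
      inv_mem' := by
        rintro _ ⟨⟨y, z⟩, h, rfl⟩
        by_cases hy : y = 0
        · exact ⟨_, h, by simp [hy]⟩
        · exact ⟨_, inv_mem_of_maximal_signCompatible hΓ h hy, rfl⟩ }
  have hE : ∀ y, y ∈ E ↔ ∃ z, (y, z) ∈ Γ := by
    intro y
    constructor
    · rintro ⟨⟨y, z⟩, h, rfl⟩
      exact ⟨z, h⟩
    · rintro ⟨z, h⟩
      exact ⟨_, h, rfl⟩
  refine ⟨E, fun c hc => (hE c).mpr ⟨_, hFΓ ⟨c, hc⟩⟩, (hE t).mpr ⟨_, htΓ⟩, ?_, ?_⟩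
  · rintro y ⟨p, hp, hpy⟩
    let π : Γ →+* E := (projFst Γ).codRestrict E fun p => (hE _).mpr ⟨p.1.2, p.2⟩
    have hπ : Function.Surjective π := by
      rintro ⟨y, hy⟩
      obtain ⟨z, hz⟩ := (hE y).mp hy
      exact ⟨⟨_, hz⟩, rfl⟩
    obtain ⟨Q, rfl⟩ := Polynomial.map_surjective π hπ p
    have hQ : Q ≠ 0 := by rintro rfl; simp at hp
    rw [Polynomial.aeval_def, Polynomial.eval₂_map] at hpy
    obtain ⟨m, rfl⟩ := (exists_mem_of_maximal_signCompatible hR hG hΓ Q hQ).1 y hpy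
    exact (π m).2
  · intro σ h y hy
    choose z hz using fun i => (hE (y i)).mp (y i).2
    choose b hb using fun i => (z i).inductionOn (p := fun g => ∃ b : Finset F → F,
      (b : G) = g) fun b => ⟨b, rfl⟩
    let ρ : ℝ →+* R × G := (algebraMap ℝ R).prod (cst.comp (algebraMap ℝ F))
    let w : σ → R × G := fun i => (y i, z i)
    have hmem : h.eval₂ ρ w ∈ Γ :=
      MvPolynomial.eval₂_mem (s := Γ) (fun i _ => hFΓ (algebraMap ℝ F _)) hz
    have e1 : (h.eval₂ ρ w).1 = 0 := by
      have h1 := MvPolynomial.eval₂_comp_left (RingHom.fst R G) ρ w h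
      have h2 := MvPolynomial.eval₂_comp_left (algebraMap E R) (algebraMap ℝ E) y h
      rw [← MvPolynomial.aeval_def, hy, map_zero] at h2
      exact h1.trans h2.symm
    have e2 := (hΓ.prop.eq_zero_iff hmem).mp e1
    have e3 := (MvPolynomial.eval₂_comp_left (RingHom.snd R G) ρ w h).symm.trans e2
    have e4 := germ_eval₂ (U := U) (algebraMap ℝ F) b h
    have e5 : (h.eval₂ ((RingHom.snd R G).comp ρ) (RingHom.snd R G ∘ w)) =
        ((fun k => h.eval₂ (algebraMap ℝ F) fun i => b i k : Finset F → F) : G) := by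
      refine Eq.trans ?_ e4
      congr 1
      funext i
      exact (hb i).symm
    rw [e5] at e3
    have e6 := Germ.coe_eq.mp (e3.trans Germ.coe_zero.symm)
    obtain ⟨k, hk⟩ := e6.exists
    exact hF' σ h (fun i => b i k) hk

/-- Transfer of solvability of polynomial equations from an ordered field with the intermediate
value property for polynomials to the reals. -/
theorem PolyIVT.hasRealPoints (hR : PolyIVT R) {σ : Type} [Finite σ] (h : MvPolynomial σ ℝ)
    (y : σ → R) (hy : aeval y h = 0) : ∃ x : σ → ℝ, eval x h = 0 := by
  have key : ∀ s : Set R, s.Finite → ∃ E : IntermediateField ℝ R, s ⊆ E ∧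
      (∀ y : R, IsAlgebraic E y → y ∈ E) ∧ HasRealPoints E := by
    intro s hs
    induction s, hs using Set.Finite.induction_on with
    | empty => exact ⟨⊥, by simp, mem_bot_of_isAlgebraic_real, hasRealPoints_bot⟩
    | insert _ _ ih =>
      rename_i t s _ _
      obtain ⟨F, h1, h2, h3⟩ := ih
      obtain ⟨E, h4, h5, h6, h7⟩ := exists_intermediateField_mem_hasRealPoints hR F h2 h3 t
      exact ⟨E, Set.insert_subset h5 (h1.trans h4), h6, h7⟩
  obtain ⟨E, h1, -, h3⟩ := key (Set.range y) (Set.finite_range y)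
  refine h3 σ h (fun i => ⟨y i, h1 ⟨i, rfl⟩⟩) (Subtype.val_injective ?_)
  have h2 := MvPolynomial.eval₂_comp_left (algebraMap E R) (algebraMap ℝ E)
    (fun i => ⟨y i, h1 ⟨i, rfl⟩⟩) h
  exact h2.trans hy

end RealPoints

section SquareCone

variable {A Ω : Type*} [CommRing A] [Field Ω] (φ : A →+* Ω) (T : Subsemiring A)

/-- Sums of squares of elements of `L` weighted by elements of `φ(T)`. -/
def sqCone (L : Subfield Ω) : AddSubmonoid Ω :=
  AddSubmonoid.closure {x | ∃ t ∈ T, ∃ r ∈ L, x = φ t * r ^ 2}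

variable {φ T} {L : Subfield Ω}

theorem mul_sq_mem_sqCone {t : A} (ht : t ∈ T) {r : Ω} (hr : r ∈ L) :
    φ t * r ^ 2 ∈ sqCone φ T L :=
  AddSubmonoid.subset_closure ⟨t, ht, r, hr, rfl⟩

theorem sq_mem_sqCone {r : Ω} (hr : r ∈ L) : r ^ 2 ∈ sqCone φ T L := by
  simpa using mul_sq_mem_sqCone (φ := φ) (one_mem T) hr

theorem map_mem_sqCone {t : A} (ht : t ∈ T) : φ t ∈ sqCone φ T L := by
  simpa using mul_sq_mem_sqCone (φ := φ) ht (one_mem L)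

theorem one_mem_sqCone : (1 : Ω) ∈ sqCone φ T L := by
  simpa using sq_mem_sqCone (φ := φ) (T := T) (one_mem L)

theorem mul_mem_sqCone {x y : Ω} (hx : x ∈ sqCone φ T L) (hy : y ∈ sqCone φ T L) :
    x * y ∈ sqCone φ T L := by
  induction hx using AddSubmonoid.closure_induction with
  | zero => rw [zero_mul]; exact zero_mem _
  | add u v _ _ hu hv => rw [add_mul]; exact add_mem hu hv
  | mem u hu =>
    obtain ⟨t, ht, r, hr, rfl⟩ := hu
    induction hy using AddSubmonoid.closure_induction with
    | zero => rw [mul_zero]; exact zero_mem _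
    | add u v _ _ hu hv => rw [mul_add]; exact add_mem hu hv
    | mem u hu =>
      obtain ⟨t', ht', r', hr', rfl⟩ := hu
      have := mul_sq_mem_sqCone (φ := φ) (mul_mem ht ht') (mul_mem hr hr')
      rwa [map_mul, mul_pow, mul_mul_mul_comm] at this

theorem sqCone_le (hL : φ.range ≤ L.toSubring) {x : Ω} (hx : x ∈ sqCone φ T L) : x ∈ L := by
  induction hx using AddSubmonoid.closure_induction with
  | zero => exact zero_mem _
  | add u v _ _ hu hv => exact add_mem hu hv
  | mem u hu =>
    obtain ⟨t, _, r, hr, rfl⟩ := hu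
    exact mul_mem (hL ⟨t, rfl⟩) (pow_mem hr 2)

/-- The subfield generated by `α` over `L`. -/
def subfieldAdjoin (L : Subfield Ω) (α : Ω) : Subfield Ω :=
  (IntermediateField.adjoin L {α}).toSubfield

theorem le_subfieldAdjoin (L : Subfield Ω) (α : Ω) : L ≤ subfieldAdjoin L α := fun x hx =>
  (IntermediateField.adjoin L {α}).algebraMap_mem ⟨x, hx⟩

theorem mem_subfieldAdjoin_self (L : Subfield Ω) (α : Ω) : α ∈ subfieldAdjoin L α :=
  IntermediateField.mem_adjoin_simple_self L α

theorem exists_aeval_eq_of_mem_subfieldAdjoin {α : Ω} {p : L[X]} (hp : p.Monic) (hp1 : p ≠ 1)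
    (hα : Polynomial.aeval α p = 0) {x : Ω} (hx : x ∈ subfieldAdjoin L α) :
    ∃ g : L[X], g.natDegree < p.natDegree ∧ Polynomial.aeval α g = x := by
  have halg : IsAlgebraic L α := ⟨p, hp.ne_zero, hα⟩
  have hx' : x ∈ (IntermediateField.adjoin L {α}).toSubalgebra := hx
  rw [IntermediateField.adjoin_simple_toSubalgebra_of_isAlgebraic halg,
    Algebra.adjoin_singleton_eq_range_aeval] at hx'
  obtain ⟨g, rfl⟩ := hx'
  refine ⟨g %ₘ p, Polynomial.natDegree_modByMonic_lt g hp hp1, ?_⟩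
  conv_rhs => rw [← Polynomial.modByMonic_add_div g p]
  simp [hα]

theorem exists_polynomial_of_mem_sqCone (hL : φ.range ≤ L.toSubring) {α : Ω} {p : L[X]}
    (hp : p.Monic) (hp1 : p ≠ 1) (hα : Polynomial.aeval α p = 0) {x : Ω}
    (hx : x ∈ sqCone φ T (subfieldAdjoin L α)) :
    ∃ G : L[X], G.natDegree ≤ 2 * (p.natDegree - 1) ∧ Polynomial.aeval α G = x ∧
      ∀ c : L, ((G.eval c : L) : Ω) ∈ sqCone φ T L := by
  induction hx using AddSubmonoid.closure_induction with
  | zero => exact ⟨0, by simp, by simp, fun c => by simp⟩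
  | add u v _ _ hu hv =>
    obtain ⟨G, h1, h2, h3⟩ := hu
    obtain ⟨H, h4, h5, h6⟩ := hv
    refine ⟨G + H, Polynomial.natDegree_add_le_of_degree_le h1 h4, by simp [h2, h5], fun c => ?_⟩
    rw [Polynomial.eval_add]
    exact add_mem (h3 c) (h6 c)
  | mem u hu =>
    obtain ⟨t, ht, r, hr, rfl⟩ := hu
    obtain ⟨g, hg, rfl⟩ := exists_aeval_eq_of_mem_subfieldAdjoin hp hp1 hα hr
    refine ⟨Polynomial.C ⟨φ t, hL ⟨t, rfl⟩⟩ * g ^ 2, ?_, ?_, fun c => ?_⟩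
    · refine (Polynomial.natDegree_C_mul_le _ _).trans (Polynomial.natDegree_pow_le.trans ?_)
      omega
    · rw [map_mul, map_pow, Polynomial.aeval_C]
      rfl
    · rw [Polynomial.eval_mul, Polynomial.eval_C, Polynomial.eval_pow]
      exact mul_sq_mem_sqCone ht (g.eval c).2

theorem exists_of_mem_sqCone_sqrt (hL : φ.range ≤ L.toSubring) {a α : Ω} (ha : a ∈ L)
    (hα : α ^ 2 = a) {x : Ω} (hx : x ∈ sqCone φ T (subfieldAdjoin L α)) :
    ∃ u ∈ sqCone φ T L, ∃ v ∈ sqCone φ T L, ∃ w ∈ L, x = u + a * v + w * α := by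
  induction hx using AddSubmonoid.closure_induction with
  | zero => exact ⟨0, zero_mem _, 0, zero_mem _, 0, zero_mem _, by simp⟩
  | add x y _ _ hx hy =>
    obtain ⟨u, hu, v, hv, w, hw, rfl⟩ := hx
    obtain ⟨u', hu', v', hv', w', hw', rfl⟩ := hy
    exact ⟨u + u', add_mem hu hu', v + v', add_mem hv hv', w + w', add_mem hw hw', by ring⟩
  | mem x hx =>
    obtain ⟨t, ht, r, hr, rfl⟩ := hx
    have hd : (Polynomial.X ^ 2 - Polynomial.C (⟨a, ha⟩ : L)).natDegree = 2 :=
      Polynomial.natDegree_X_pow_sub_C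
    obtain ⟨g, hg, rfl⟩ := exists_aeval_eq_of_mem_subfieldAdjoin
      (Polynomial.monic_X_pow_sub_C (⟨a, ha⟩ : L) two_ne_zero)
      (fun h => by rw [h, Polynomial.natDegree_one] at hd; omega) (by
        rw [map_sub, map_pow, Polynomial.aeval_X, Polynomial.aeval_C, hα]
        exact sub_self a) hr
    rw [hd] at hg
    obtain ⟨q, p, rfl⟩ := Polynomial.exists_eq_X_add_C_of_natDegree_le_one (Nat.le_of_lt_succ hg)
    refine ⟨_, mul_sq_mem_sqCone ht p.2, _, mul_sq_mem_sqCone ht q.2, φ t * 2 * p * q,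
      mul_mem (mul_mem (mul_mem (hL ⟨t, rfl⟩) (ofNat_mem L 2)) p.2) q.2, ?_⟩
    rw [map_add, map_mul, Polynomial.aeval_C, Polynomial.aeval_X, Polynomial.aeval_C, ← hα]
    change φ t * ((q : Ω) * α + p) ^ 2 = _
    ring

theorem exists_maximal_sqCone (L₀ : Subfield Ω) (h₀ : -1 ∉ sqCone φ T L₀) :
    ∃ L, L₀ ≤ L ∧ Maximal (fun L => -1 ∉ sqCone φ T L) L := by
  refine zorn_le_nonempty₀ {L : Subfield Ω | -1 ∉ sqCone φ T L} ?_ L₀ h₀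
  intro c hc hchain L hL
  refine ⟨sSup c, ?_, fun _ h => le_sSup h⟩
  have key : ∀ x ∈ sqCone φ T (sSup c), ∃ M ∈ c, x ∈ sqCone φ T M := by
    intro x hx
    have mono : ∀ {M N : Subfield Ω}, M ≤ N → sqCone φ T M ≤ sqCone φ T N := fun h =>
      AddSubmonoid.closure_mono fun _ ⟨t, ht, r, hr, e⟩ => ⟨t, ht, r, h hr, e⟩
    induction hx using AddSubmonoid.closure_induction with
    | zero => exact ⟨L, hL, zero_mem _⟩
    | add u v _ _ hu hv =>
      obtain ⟨M, hM, hu⟩ := hu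
      obtain ⟨N, hN, hv⟩ := hv
      rcases hchain.total hM hN with h | h
      · exact ⟨N, hN, add_mem (mono h hu) hv⟩
      · exact ⟨M, hM, add_mem hu (mono h hv)⟩
    | mem u hu =>
      obtain ⟨t, ht, r, hr, rfl⟩ := hu
      rw [Subfield.mem_sSup_of_directedOn ⟨L, hL⟩ hchain.directedOn] at hr
      obtain ⟨M, hM, hr⟩ := hr
      exact ⟨M, hM, mul_sq_mem_sqCone ht hr⟩
  intro h
  obtain ⟨M, hM, h⟩ := key _ h
  exact hc hM h

theorem neg_one_mem_sqCone_subfieldAdjoin (hmax : Maximal (fun L => -1 ∉ sqCone φ T L) L)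
    {α : Ω} (hα : α ∉ L) : -1 ∈ sqCone φ T (subfieldAdjoin L α) := by
  by_contra h
  exact hα (hmax.le_of_ge h (le_subfieldAdjoin L α) (mem_subfieldAdjoin_self L α))

theorem mem_sqCone_or_neg_mem [IsAlgClosed Ω] (hL : φ.range ≤ L.toSubring)
    (hmax : Maximal (fun L => -1 ∉ sqCone φ T L) L) {a : Ω} (ha : a ∈ L) :
    a ∈ sqCone φ T L ∨ -a ∈ sqCone φ T L := by
  obtain ⟨α, rfl⟩ := IsAlgClosed.exists_pow_nat_eq a two_pos
  by_cases hα : α ∈ L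
  · exact Or.inl (sq_mem_sqCone hα)
  obtain ⟨u, hu, v, hv, w, hw, h⟩ := exists_of_mem_sqCone_sqrt hL ha rfl
    (neg_one_mem_sqCone_subfieldAdjoin hmax hα)
  have huL := sqCone_le hL hu
  have hvL := sqCone_le hL hv
  have hw0 : w = 0 := by
    by_contra hw0
    apply hα
    have : α = (-1 - u - α ^ 2 * v) / w := by
      rw [eq_div_iff hw0, h]; ring
    rw [this]
    exact div_mem (sub_mem (sub_mem (neg_mem (one_mem L)) huL) (mul_mem ha hvL)) hw
  rw [hw0, zero_mul, add_zero] at h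
  have hv0 : v ≠ 0 := by
    rintro rfl
    rw [mul_zero, add_zero] at h
    exact hmax.prop (h ▸ hu)
  right
  have : -α ^ 2 = (1 + u) * v * (v⁻¹) ^ 2 := by
    have : 1 + u = -α ^ 2 * v := by linear_combination -h
    rw [this]
    field_simp
  rw [this]
  exact mul_mem_sqCone (mul_mem_sqCone (add_mem one_mem_sqCone hu) hv)
    (sq_mem_sqCone (inv_mem hvL))

theorem eq_zero_of_mem_sqCone_of_neg_mem (hL : φ.range ≤ L.toSubring)
    (h : -1 ∉ sqCone φ T L) {x : Ω} (hx : x ∈ sqCone φ T L) (hx' : -x ∈ sqCone φ T L) :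
    x = 0 := by
  by_contra h0
  apply h
  have : -1 = x * (-x) * (x⁻¹) ^ 2 := by field_simp
  rw [this]
  exact mul_mem_sqCone (mul_mem_sqCone hx hx') (sq_mem_sqCone (inv_mem (sqCone_le hL hx)))

theorem polyIVT_of_maximal_sqCone [IsAlgClosed Ω] (hL : φ.range ≤ L.toSubring)
    (hmax : Maximal (fun L => -1 ∉ sqCone φ T L) L) [LinearOrder L] [IsStrictOrderedRing L]
    (hord : ∀ x : L, 0 ≤ x ↔ (x : Ω) ∈ sqCone φ T L) : PolyIVT L := by
  suffices ∀ n, ∀ (p : L[X]) (a b : L), p.natDegree = n → a < b → p.eval a * p.eval b < 0 →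
      ∃ c, a < c ∧ c < b ∧ p.eval c = 0 from fun p a b => this _ p a b rfl
  intro n
  induction n using Nat.strong_induction_on with
  | _ n ih =>
  intro p a b hn hab hp
  have hp0 : p ≠ 0 := by rintro rfl; simp at hp
  have hpu : ¬ IsUnit p := by
    intro hu
    obtain ⟨c, -, rfl⟩ := Polynomial.isUnit_iff.mp hu
    rw [Polynomial.eval_C, Polynomial.eval_C] at hp
    exact not_lt.mpr (mul_self_nonneg c) hp
  by_cases hirr : Irreducible p
  swap
  · rw [irreducible_iff] at hirr
    push Not at hirr
    obtain ⟨q, r, rfl, hq, hr⟩ := hirr hpu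
    have hq0 := left_ne_zero_of_mul hp0
    have hr0 := right_ne_zero_of_mul hp0
    rw [Polynomial.natDegree_mul hq0 hr0] at hn
    have hqd := Polynomial.natDegree_pos_iff_degree_pos.mpr
      (Polynomial.degree_pos_of_ne_zero_of_nonunit hq0 hq)
    have hrd := Polynomial.natDegree_pos_iff_degree_pos.mpr
      (Polynomial.degree_pos_of_ne_zero_of_nonunit hr0 hr)
    rw [Polynomial.eval_mul, Polynomial.eval_mul, mul_mul_mul_comm] at hp
    rcases mul_neg_iff.mp hp with ⟨-, h⟩ | ⟨h, -⟩
    · obtain ⟨c, h1, h2, h3⟩ := ih r.natDegree (by omega) r a b rfl hab h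
      exact ⟨c, h1, h2, by rw [Polynomial.eval_mul, h3, mul_zero]⟩
    · obtain ⟨c, h1, h2, h3⟩ := ih q.natDegree (by omega) q a b rfl hab h
      exact ⟨c, h1, h2, by rw [Polynomial.eval_mul, h3, zero_mul]⟩
  wlog hmon : p.Monic generalizing p
  · have hl : p.leadingCoeff ≠ 0 := Polynomial.leadingCoeff_ne_zero.mpr hp0
    have hl' : p.leadingCoeff⁻¹ ≠ 0 := inv_ne_zero hl
    have hu : IsUnit (Polynomial.C p.leadingCoeff⁻¹) :=
      Polynomial.isUnit_C.mpr (isUnit_iff_ne_zero.mpr hl')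
    obtain ⟨c, h1, h2, h3⟩ := this (p * Polynomial.C p.leadingCoeff⁻¹)
      (by rw [Polynomial.natDegree_mul_C hl', hn])
      (by
        simp only [Polynomial.eval_mul, Polynomial.eval_C]
        rw [mul_mul_mul_comm]
        exact mul_neg_of_neg_of_pos hp (mul_self_pos.mpr hl'))
      (mul_ne_zero hp0 (Polynomial.C_ne_zero.mpr hl'))
      (fun h => hpu (isUnit_of_mul_isUnit_left h))
      ((irreducible_mul_isUnit hu).mpr hirr)
      (Polynomial.monic_mul_leadingCoeff_inv hp0)
    refine ⟨c, h1, h2, ?_⟩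
    rw [Polynomial.eval_mul, Polynomial.eval_C] at h3
    exact (mul_eq_zero.mp h3).resolve_right hl'
  have hpos : 0 < p.natDegree := Polynomial.natDegree_pos_iff_degree_pos.mpr
      (Polynomial.degree_pos_of_ne_zero_of_nonunit hp0 hpu)
  rcases Nat.lt_or_ge 1 p.natDegree with hd | hd
  swap
  · obtain ⟨c, rfl⟩ : ∃ c, p = Polynomial.X + Polynomial.C c :=
      ⟨_, hmon.eq_X_add_C (by omega)⟩
    simp only [Polynomial.eval_add, Polynomial.eval_X, Polynomial.eval_C] at hp
    refine ⟨-c, ?_, ?_, by simp⟩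
    · rcases mul_neg_iff.mp hp with h | h <;> linarith
    · rcases mul_neg_iff.mp hp with h | h <;> linarith
  obtain ⟨α, hα⟩ := IsAlgClosed.exists_aeval_eq_zero Ω p
    (Polynomial.degree_pos_of_ne_zero_of_nonunit hp0 hpu).ne'
  have hαL : α ∉ L := by
    intro h
    have h1 : p.IsRoot (⟨α, h⟩ : L) := by
      apply Subtype.val_injective
      have := Polynomial.eval₂_at_apply (p := p) (algebraMap L Ω) ⟨α, h⟩
      exact this.symm.trans hα
    have : p.natDegree = 1 := Polynomial.natDegree_eq_of_degree_eq_some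
      (Polynomial.degree_eq_one_of_irreducible_of_root hirr h1)
    omega
  obtain ⟨G, hGd, hG, hGe⟩ := exists_polynomial_of_mem_sqCone hL hmon
    (fun h => hpu (h ▸ isUnit_one)) hα (neg_one_mem_sqCone_subfieldAdjoin hmax hαL)
  have hGp : ∀ c, 0 < (1 + G).eval c := by
    intro c
    rw [Polynomial.eval_add, Polynomial.eval_one]
    have := (hord _).mpr (hGe c)
    linarith
  have hG0 : 1 + G ≠ 0 := by
    intro h
    have := hGp 0
    rw [h] at this
    simp at this
  obtain ⟨h, hh⟩ : p ∣ 1 + G := by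
    rw [minpoly.eq_of_irreducible_of_monic hirr hα hmon]
    exact minpoly.dvd _ _ (by simp [hG])
  have hh0 : h ≠ 0 := by rintro rfl; exact hG0 (by rw [hh, mul_zero])
  have hhd : h.natDegree < n := by
    have h1 : (1 + G).natDegree ≤ 2 * (p.natDegree - 1) :=
      Polynomial.natDegree_add_le_of_degree_le (by simp) hGd
    rw [hh, Polynomial.natDegree_mul hp0 hh0] at h1
    omega
  have hha := hGp a
  have hhb := hGp b
  rw [hh, Polynomial.eval_mul] at hha hhb
  obtain ⟨c, h1, h2, h3⟩ := ih _ hhd h a b rfl hab (by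
    have := mul_pos hha hhb
    rw [mul_mul_mul_comm] at this
    by_contra h'
    exact absurd this (not_lt.mpr (mul_nonpos_of_nonpos_of_nonneg hp.le (not_lt.mp h'))))
  have := hGp c
  rw [hh, Polynomial.eval_mul, h3, mul_zero] at this
  exact absurd this (lt_irrefl _)

end SquareCone

section Existence

universe u

variable {A : Type u} [CommRing A]

theorem exists_linearOrder_of_cone {L : Type*} [Field L] (P : Subsemiring L)
    (h₁ : ∀ x, x ∈ P ∨ -x ∈ P) (h₂ : ∀ x, x ∈ P → -x ∈ P → x = 0) :
    ∃ _ : LinearOrder L, IsStrictOrderedRing L ∧ ∀ x : L, 0 ≤ x ↔ x ∈ P := by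
  classical
  let C : RingCone L := { P with eq_zero_of_mem_of_neg_mem' := fun {x} => h₂ x }
  have : HasMemOrNegMem C := ⟨h₁⟩
  let lo : LinearOrder L := LinearOrder.mkOfAddGroupCone C
  have : IsOrderedRing L := IsOrderedRing.mkOfCone C
  refine ⟨lo, IsOrderedRing.toIsStrictOrderedRing L, fun x => ?_⟩
  change x - 0 ∈ P ↔ _
  rw [sub_zero]

/-- The multiplicative set `1 + T`. -/
def onePlus (T : Subsemiring A) : Submonoid A where
  carrier := {s | ∃ t ∈ T, s = 1 + t}
  one_mem' := ⟨0, zero_mem T, by simp⟩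
  mul_mem' := by
    rintro _ _ ⟨t, ht, rfl⟩ ⟨u, hu, rfl⟩
    exact ⟨t + u + t * u, add_mem (add_mem ht hu) (mul_mem ht hu), by ring⟩

theorem exists_field_of_neg_one_notMem (T : Subsemiring A) (h : -1 ∉ T) :
    ∃ (K : Type u) (_ : Field K) (φ : A →+* K), (∀ s ∈ onePlus T, φ s ≠ 0) ∧
      ∀ r : K, ∃ a, ∃ s ∈ onePlus T, φ s * r = φ a := by
  let B := Localization (onePlus T)
  have : Nontrivial B := by
    rw [← not_subsingleton_iff_nontrivial, IsLocalization.subsingleton_iff (S := B) (M := onePlus T)]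
    rintro ⟨t, ht, e⟩
    exact h (by rwa [← eq_neg_of_add_eq_zero_right e.symm])
  obtain ⟨I, hI⟩ := Ideal.exists_maximal B
  let _ : Field (B ⧸ I) := Ideal.Quotient.field I
  refine ⟨B ⧸ I, inferInstance, (Ideal.Quotient.mk I).comp (algebraMap A B), fun s hs =>
    ((IsLocalization.map_units B (⟨s, hs⟩ : onePlus T)).map (Ideal.Quotient.mk I)).ne_zero,
    fun r => ?_⟩
  obtain ⟨b, rfl⟩ := Ideal.Quotient.mk_surjective r
  obtain ⟨⟨a, s⟩, hb⟩ := IsLocalization.surj (onePlus T) b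
  refine ⟨a, s, s.2, ?_⟩
  change Ideal.Quotient.mk I (algebraMap A B s) * _ = Ideal.Quotient.mk I (algebraMap A B a)
  rw [← hb, map_mul, mul_comm]

/-- A preordering not containing `-1` is mapped to the nonnegative elements under a suitable ring
homomorphism into an ordered field with the intermediate value property for polynomials. -/
theorem exists_polyIVT_of_neg_one_notMem (T : Subsemiring A) (hT : ∀ a, a ^ 2 ∈ T) (h : -1 ∉ T) :
    ∃ (R : Type u) (_ : Field R) (_ : LinearOrder R) (_ : IsStrictOrderedRing R) (φ : A →+* R),
      PolyIVT R ∧ ∀ t ∈ T, 0 ≤ φ t := by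
  obtain ⟨K, _, ψ, hψ, hψ'⟩ := exists_field_of_neg_one_notMem T h
  let Ω := AlgebraicClosure K
  let φ : A →+* Ω := (algebraMap K Ω).comp ψ
  have h₀ : -1 ∉ sqCone φ T (algebraMap K Ω).fieldRange := by
    intro hmem
    have key : ∀ x ∈ sqCone φ T (algebraMap K Ω).fieldRange, ∃ s ∈ onePlus T, ∃ t ∈ T,
        φ s ^ 2 * x = φ t := by
      intro x hx
      induction hx using AddSubmonoid.closure_induction with
      | zero => exact ⟨1, one_mem _, 0, zero_mem _, by simp⟩
      | add x y _ _ hx hy =>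
        obtain ⟨s, hs, t, ht, e⟩ := hx
        obtain ⟨s', hs', t', ht', e'⟩ := hy
        refine ⟨s * s', mul_mem hs hs', s' ^ 2 * t + s ^ 2 * t',
          add_mem (mul_mem (hT _) ht) (mul_mem (hT _) ht'), ?_⟩
        simp only [map_add, map_mul, map_pow]
        rw [← e, ← e']
        ring
      | mem x hx =>
        obtain ⟨t, ht, _, ⟨r, rfl⟩, rfl⟩ := hx
        obtain ⟨a, s, hs, e⟩ := hψ' r
        refine ⟨s, hs, t * a ^ 2, mul_mem ht (hT a), ?_⟩
        have e' : φ s * algebraMap K Ω r = φ a := by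
          have := congrArg (algebraMap K Ω) e
          rwa [map_mul] at this
        rw [map_mul, map_pow, ← e']
        ring
    obtain ⟨s, hs, t, ht, e⟩ := key _ hmem
    obtain ⟨u, hu, rfl⟩ := hs
    refine hψ ((1 + u) ^ 2 + t)
      ⟨u + u + u ^ 2 + t, add_mem (add_mem (add_mem hu hu) (hT u)) ht, by ring⟩ ?_
    apply (algebraMap K Ω).injective
    change φ _ = _
    rw [map_add, map_pow, map_zero, ← e]
    ring
  obtain ⟨L, hL₀, hL⟩ := exists_maximal_sqCone _ h₀
  have hφL : φ.range ≤ L.toSubring := by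
    rintro _ ⟨a, rfl⟩
    exact hL₀ ⟨ψ a, rfl⟩
  let P : Subsemiring L :=
    { carrier := {x | (x : Ω) ∈ sqCone φ T L}
      mul_mem' := mul_mem_sqCone
      one_mem' := one_mem_sqCone
      add_mem' := (sqCone φ T L).add_mem
      zero_mem' := (sqCone φ T L).zero_mem }
  obtain ⟨lo, hlo, hP⟩ := exists_linearOrder_of_cone P
    (fun x => mem_sqCone_or_neg_mem hφL hL x.2)
    (fun x hx hx' => Subtype.val_injective (eq_zero_of_mem_sqCone_of_neg_mem hφL hL.prop hx hx'))
  exact ⟨L, inferInstance, lo, hlo, φ.codRestrict L fun a => hφL ⟨a, rfl⟩,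
    polyIVT_of_maximal_sqCone hφL hL hP, fun t ht => (hP _).mpr (map_mem_sqCone ht)⟩

end Existence

section Cones

variable {σ ι : Type*} [Fintype ι]

theorem isSOS_iff_isSumSq {p : MvPolynomial σ ℝ} : IsSOS p ↔ IsSumSq p := by
  constructor
  · rintro ⟨k, q, rfl⟩
    exact IsSumSq.sum fun i _ => (sq (q i)) ▸ IsSumSq.mul_self (q i)
  · intro h
    induction h with
    | zero => exact ⟨0, ![], by simp⟩
    | sq_add a _ ih =>
      obtain ⟨k, q, rfl⟩ := ih
      exact ⟨k + 1, Fin.cons a q, by rw [Fin.sum_univ_succ]; simp [sq]⟩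

theorem IsSOS.zero : IsSOS (0 : MvPolynomial σ ℝ) := isSOS_iff_isSumSq.mpr .zero

theorem IsSOS.sq (p : MvPolynomial σ ℝ) : IsSOS (p ^ 2) :=
  isSOS_iff_isSumSq.mpr (by rw [_root_.sq]; exact .mul_self p)

theorem IsSOS.one : IsSOS (1 : MvPolynomial σ ℝ) := by simpa using IsSOS.sq (1 : MvPolynomial σ ℝ)

theorem IsSOS.add {p q : MvPolynomial σ ℝ} (hp : IsSOS p) (hq : IsSOS q) : IsSOS (p + q) :=
  isSOS_iff_isSumSq.mpr ((isSOS_iff_isSumSq.mp hp).add (isSOS_iff_isSumSq.mp hq))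

theorem IsSOS.mul {p q : MvPolynomial σ ℝ} (hp : IsSOS p) (hq : IsSOS q) : IsSOS (p * q) :=
  isSOS_iff_isSumSq.mpr ((isSOS_iff_isSumSq.mp hp).mul (isSOS_iff_isSumSq.mp hq))

theorem IsSOS.map {σ τ : Type*} {p : MvPolynomial σ ℝ} (hp : IsSOS p)
    (φ : MvPolynomial σ ℝ →+* MvPolynomial τ ℝ) : IsSOS (φ p) := by
  obtain ⟨k, q, rfl⟩ := hp
  exact ⟨k, fun i => φ (q i), by simp⟩

variable {g : ι → MvPolynomial σ ℝ}

theorem InQM.of_isSOS {p : MvPolynomial σ ℝ} (hp : IsSOS p) : InQM g p :=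
  ⟨p, 0, hp, fun _ => .zero, by simp⟩

theorem InQM.add {p q : MvPolynomial σ ℝ} (hp : InQM g p) (hq : InQM g q) : InQM g (p + q) := by
  obtain ⟨s, t, hs, ht, rfl⟩ := hp
  obtain ⟨s', t', hs', ht', rfl⟩ := hq
  refine ⟨s + s', t + t', hs.add hs', fun j => (ht j).add (ht' j), ?_⟩
  simp only [Pi.add_apply, add_mul, Finset.sum_add_distrib]
  ring

theorem InQM.sos_mul {p q : MvPolynomial σ ℝ} (hp : IsSOS p) (hq : InQM g q) :
    InQM g (p * q) := by
  obtain ⟨s, t, hs, ht, rfl⟩ := hq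
  refine ⟨p * s, fun j => p * t j, hp.mul hs, fun j => hp.mul (ht j), ?_⟩
  rw [mul_add, Finset.mul_sum]
  simp only [mul_assoc]

theorem InQM.generator (j : ι) : InQM g (g j) := by
  classical
  refine ⟨0, Pi.single j 1, .zero, fun i => ?_, ?_⟩
  · rcases eq_or_ne i j with rfl | h
    · simpa using IsSOS.one
    · simpa [Pi.single_eq_of_ne h] using IsSOS.zero
  · simp [Pi.single_apply]

theorem InQM.sum {κ : Type*} (s : Finset κ) {p : κ → MvPolynomial σ ℝ}
    (h : ∀ i ∈ s, InQM g (p i)) : InQM g (∑ i ∈ s, p i) := by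
  classical
  induction s using Finset.induction_on with
  | empty => simpa using InQM.of_isSOS IsSOS.zero
  | insert a s ha ih =>
    rw [Finset.sum_insert ha]
    exact (h a (Finset.mem_insert_self a s)).add
      (ih fun i hi => h i (Finset.mem_insert_of_mem hi))

theorem InQM.map {τ : Type*} {p : MvPolynomial σ ℝ} (hp : InQM g p)
    (φ : MvPolynomial σ ℝ →+* MvPolynomial τ ℝ) : InQM (fun j => φ (g j)) (φ p) := by
  obtain ⟨s, t, hs, ht, rfl⟩ := hp
  exact ⟨φ s, fun j => φ (t j), hs.map φ, fun j => (ht j).map φ, by simp⟩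

variable [DecidableEq ι]

theorem InPre.monomial {s : MvPolynomial σ ℝ} (hs : IsSOS s) (A : Finset ι) :
    InPre g (s * ∏ j ∈ A, g j) := by
  refine ⟨Pi.single A s, fun B => ?_, ?_⟩
  · rcases eq_or_ne B A with rfl | h
    · simpa using hs
    · simpa [Pi.single_eq_of_ne h] using IsSOS.zero
  · simp [Pi.single_apply]

theorem InPre.of_isSOS {p : MvPolynomial σ ℝ} (hp : IsSOS p) : InPre g p := by
  simpa using InPre.monomial (g := g) hp ∅

theorem InPre.generator (j : ι) : InPre g (g j) := by
  simpa using InPre.monomial (g := g) IsSOS.one {j}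

theorem InPre.add {p q : MvPolynomial σ ℝ} (hp : InPre g p) (hq : InPre g q) :
    InPre g (p + q) := by
  obtain ⟨s, hs, rfl⟩ := hp
  obtain ⟨t, ht, rfl⟩ := hq
  refine ⟨s + t, fun A => (hs A).add (ht A), ?_⟩
  simp only [Pi.add_apply, add_mul, Finset.sum_add_distrib]

theorem InPre.sum {κ : Type*} (s : Finset κ) {p : κ → MvPolynomial σ ℝ}
    (h : ∀ i ∈ s, InPre g (p i)) : InPre g (∑ i ∈ s, p i) := by
  classical
  induction s using Finset.induction_on with
  | empty => simpa using InPre.of_isSOS IsSOS.zero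
  | insert a s ha ih =>
    rw [Finset.sum_insert ha]
    exact (h a (Finset.mem_insert_self a s)).add
      (ih fun i hi => h i (Finset.mem_insert_of_mem hi))

theorem InPre.mul {p q : MvPolynomial σ ℝ} (hp : InPre g p) (hq : InPre g q) :
    InPre g (p * q) := by
  obtain ⟨s, hs, rfl⟩ := hp
  obtain ⟨t, ht, rfl⟩ := hq
  rw [Finset.sum_mul_sum]
  refine InPre.sum _ fun A _ => InPre.sum _ fun B _ => ?_
  have e : s A * (∏ j ∈ A, g j) * (t B * ∏ j ∈ B, g j) =
      (s A * t B * (∏ j ∈ A ∩ B, g j) ^ 2) * ∏ j ∈ (A \ B) ∪ (B \ A), g j := by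
    rw [Finset.prod_union (Finset.disjoint_left.mpr fun i hi hi' =>
      (Finset.mem_sdiff.mp hi).2 (Finset.mem_sdiff.mp hi').1),
      ← Finset.prod_inter_mul_prod_sdiff A B, ← Finset.prod_inter_mul_prod_sdiff B A,
      Finset.inter_comm B A]
    ring
  rw [e]
  exact .monomial (((hs A).mul (ht B)).mul (.sq _)) _

theorem InPre.sos_mul {p q : MvPolynomial σ ℝ} (hp : IsSOS p) (hq : InPre g q) :
    InPre g (p * q) :=
  (InPre.of_isSOS hp).mul hq

theorem InPre.map {τ : Type*} {p : MvPolynomial σ ℝ} (hp : InPre g p)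
    (φ : MvPolynomial σ ℝ →+* MvPolynomial τ ℝ) : InPre (fun j => φ (g j)) (φ p) := by
  obtain ⟨s, hs, rfl⟩ := hp
  exact ⟨fun A => φ (s A), fun A => (hs A).map φ, by simp⟩

end Cones

/-- The weak Positivstellensatz. -/
theorem exists_inPre_eq_neg_one {n m : ℕ} (g : Fin m → MvPolynomial (Fin n) ℝ)
    (f : MvPolynomial (Fin n) ℝ) (h : ∀ x ∈ Sg g, eval x f ≠ 0) :
    ∃ p q, InPre g p ∧ p + q * f = -1 := by
  let T : Subsemiring (MvPolynomial (Fin n) ℝ) :=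
    { carrier := {a | ∃ p q, InPre g p ∧ p + q * f = a}
      mul_mem' := by
        rintro _ _ ⟨p, q, hp, rfl⟩ ⟨p', q', hp', rfl⟩
        exact ⟨p * p', p * q' + q * p' + q * f * q', hp.mul hp', by ring⟩
      one_mem' := ⟨1, 0, .of_isSOS .one, by simp⟩
      add_mem' := by
        rintro _ _ ⟨p, q, hp, rfl⟩ ⟨p', q', hp', rfl⟩
        exact ⟨p + p', q + q', hp.add hp', by ring⟩
      zero_mem' := ⟨0, 0, .of_isSOS .zero, by simp⟩ }
  have hTP : ∀ p, InPre g p → p ∈ T := fun p hp => ⟨p, 0, hp, by simp⟩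
  have hTf : ∀ q, q * f ∈ T := fun q => ⟨0, q, .of_isSOS .zero, by simp⟩
  by_contra hT
  obtain ⟨R, _, _, _, φ, hR, hφ⟩ := exists_polyIVT_of_neg_one_notMem T
    (fun a => hTP _ (.of_isSOS (.sq a))) hT
  let _ : Algebra ℝ R := (φ.comp C).toAlgebra
  let ψ : MvPolynomial (Fin n) ℝ →ₐ[ℝ] R := { φ with commutes' := fun _ => rfl }
  have hψ : ∀ p, aeval (fun i => φ (X i)) p = φ p := fun p =>
    (congrArg (fun χ : MvPolynomial (Fin n) ℝ →ₐ[ℝ] R => χ p) (aeval_unique ψ)).symm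
  have hf : φ f = 0 := by
    have h1 := hφ _ (hTf 1)
    have h2 := hφ _ (hTf (-1))
    rw [neg_mul, map_neg] at h2
    rw [one_mul] at h1 h2
    exact le_antisymm (neg_nonneg.mp h2) h1
  choose s hs using fun j => hR.exists_sq_eq (hφ _ (hTP _ (InPre.generator j)))
  obtain ⟨x, hx⟩ := hR.hasRealPoints (σ := Fin n ⊕ Fin m)
    (∑ j, (rename Sum.inl (g j) - X (Sum.inr j) ^ 2) ^ 2 + rename Sum.inl f ^ 2)
    (Sum.elim (fun i => φ (X i)) s) (by
      simp only [map_add, map_sum, map_pow, map_sub, aeval_rename, aeval_X, Sum.elim_comp_inl,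
        Sum.elim_inr, hψ, hs, hf]
      simp)
  simp only [map_add, map_sum, map_pow, map_sub, eval_rename, eval_X] at hx
  have h1 : (0 : ℝ) ≤ ∑ j, (eval (x ∘ Sum.inl) (g j) - x (Sum.inr j) ^ 2) ^ 2 :=
    Finset.sum_nonneg fun _ _ => sq_nonneg _
  have h2 := sq_nonneg (eval (x ∘ Sum.inl) f)
  refine h (x ∘ Sum.inl) (fun j => ?_) (pow_eq_zero_iff two_ne_zero |>.mp (by linarith))
  have h3 := (Finset.sum_eq_zero_iff_of_nonneg (fun _ _ => sq_nonneg _)).mp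
    (le_antisymm (by linarith) h1) j (Finset.mem_univ j)
  have h4 := pow_eq_zero_iff two_ne_zero |>.mp h3
  rw [sub_eq_zero.mp h4]
  exact sq_nonneg _

section Archimedean

variable {σ : Type*}

/-- A proper quadratic module. -/
structure IsProperQuadraticModule (M : AddSubmonoid (MvPolynomial σ ℝ)) : Prop where
  one_mem : 1 ∈ M
  sq_mul_mem : ∀ a, ∀ m ∈ M, a ^ 2 * m ∈ M
  neg_one_notMem : -1 ∉ M

namespace IsProperQuadraticModule

variable {M : AddSubmonoid (MvPolynomial σ ℝ)}

theorem C_mul_mem (hM : IsProperQuadraticModule M) {r : ℝ} (hr : 0 ≤ r) {m : MvPolynomial σ ℝ}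
    (hm : m ∈ M) : C r * m ∈ M := by
  have := hM.sq_mul_mem (C (√r)) m hm
  rwa [← map_pow, Real.sq_sqrt hr] at this

theorem C_mem (hM : IsProperQuadraticModule M) {r : ℝ} (hr : 0 ≤ r) : C r ∈ M := by
  simpa using hM.C_mul_mem hr hM.one_mem

theorem C_notMem (hM : IsProperQuadraticModule M) {r : ℝ} (hr : r < 0) : C r ∉ M := by
  intro h
  have := hM.C_mul_mem (r := -r⁻¹) (by simpa using hr.le) h
  rw [← map_mul, neg_mul, inv_mul_cancel₀ hr.ne, map_neg, map_one] at this
  exact hM.neg_one_notMem this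

theorem sos_mul_mem (hM : IsProperQuadraticModule M) {s m : MvPolynomial σ ℝ} (hs : IsSOS s)
    (hm : m ∈ M) : s * m ∈ M := by
  obtain ⟨k, q, rfl⟩ := hs
  rw [Finset.sum_mul]
  exact sum_mem fun i _ => hM.sq_mul_mem _ _ hm

theorem sos_mem (hM : IsProperQuadraticModule M) {s : MvPolynomial σ ℝ} (hs : IsSOS s) : s ∈ M := by
  simpa using hM.sos_mul_mem hs hM.one_mem

theorem mul_mem_of_mem_of_neg_mem (hM : IsProperQuadraticModule M) {s : MvPolynomial σ ℝ}
    (hs : s ∈ M) (hs' : -s ∈ M) (a : MvPolynomial σ ℝ) : a * s ∈ M := by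
  have h2 : (C (1 / 2) : MvPolynomial σ ℝ) * 2 = 1 := by
    rw [show (2 : MvPolynomial σ ℝ) = C 2 from (map_ofNat C 2).symm, ← map_mul]
    norm_num
  have : a * s = (C (1 / 2) * (a + 1)) ^ 2 * s + (C (1 / 2) * (a - 1)) ^ 2 * (-s) := by
    linear_combination (-(a * s) * (C (1 / 2) * 2 + 1)) * h2
  rw [this]
  exact add_mem (hM.sq_mul_mem _ _ hs) (hM.sq_mul_mem _ _ hs')

theorem exists_maximal (hM : IsProperQuadraticModule M) :
    ∃ N, M ≤ N ∧ Maximal IsProperQuadraticModule N := by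
  refine zorn_le_nonempty₀ {N : AddSubmonoid (MvPolynomial σ ℝ) | IsProperQuadraticModule N}
    ?_ M hM
  intro c hc hchain N hN
  have key : ∀ x, x ∈ sSup c ↔ ∃ N ∈ c, x ∈ N := fun x =>
    AddSubmonoid.mem_sSup_of_directedOn ⟨N, hN⟩ hchain.directedOn
  refine ⟨sSup c, ⟨?_, ?_, ?_⟩, fun _ h => le_sSup h⟩
  · exact (key _).mpr ⟨N, hN, (hc hN).one_mem⟩
  · intro a m hm
    obtain ⟨N, hN, hm⟩ := (key _).mp hm
    exact (key _).mpr ⟨N, hN, (hc hN).sq_mul_mem a m hm⟩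
  · intro h
    obtain ⟨N, hN, h⟩ := (key _).mp h
    exact (hc hN).neg_one_notMem h

theorem exists_sos_of_notMem (hM : Maximal IsProperQuadraticModule M) {a : MvPolynomial σ ℝ}
    (ha : a ∉ M) : ∃ m ∈ M, ∃ s, IsSOS s ∧ m + s * a = -1 := by
  by_contra hne
  let N : AddSubmonoid (MvPolynomial σ ℝ) :=
    { carrier := {x | ∃ m ∈ M, ∃ s, IsSOS s ∧ m + s * a = x}
      zero_mem' := ⟨0, zero_mem M, 0, .zero, by simp⟩
      add_mem' := by
        rintro _ _ ⟨m, hm, s, hs, rfl⟩ ⟨m', hm', s', hs', rfl⟩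
        exact ⟨m + m', add_mem hm hm', s + s', hs.add hs', by ring⟩ }
  have hMN : M ≤ N := fun m hm => ⟨m, hm, 0, .zero, by simp⟩
  have hN : IsProperQuadraticModule N := by
    refine ⟨hMN hM.prop.one_mem, ?_, hne⟩
    rintro b _ ⟨m, hm, s, hs, rfl⟩
    exact ⟨b ^ 2 * m, hM.prop.sq_mul_mem b m hm, b ^ 2 * s, (IsSOS.sq b).mul hs, by ring⟩
  exact ha (hM.le_of_ge hN hMN ⟨0, zero_mem M, 1, .one, by simp⟩)

theorem mem_or_neg_mem (hM : Maximal IsProperQuadraticModule M) (a : MvPolynomial σ ℝ) :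
    a ∈ M ∨ -a ∈ M := by
  by_contra! hne
  obtain ⟨m₁, hm₁, s₁, hs₁, h₁⟩ := exists_sos_of_notMem hM hne.1
  obtain ⟨m₂, hm₂, s₂, hs₂, h₂⟩ := exists_sos_of_notMem hM hne.2
  have hP := hM.prop
  have hneg : -s₁ ∈ M := by
    have : -s₁ = s₁ * m₂ + s₂ + s₂ * m₁ := by linear_combination -s₁ * h₂ - s₂ * h₁
    rw [this]
    exact add_mem (add_mem (hP.sos_mul_mem hs₁ hm₂) (hP.sos_mem hs₂)) (hP.sos_mul_mem hs₂ hm₁)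
  apply hP.neg_one_notMem
  rw [← h₁, mul_comm]
  exact add_mem hm₁ (hP.mul_mem_of_mem_of_neg_mem (hP.sos_mem hs₁) hneg a)

/-- `p` is infinitely close to the real number `v` modulo `M`. -/
def IsNear (M : AddSubmonoid (MvPolynomial σ ℝ)) (p : MvPolynomial σ ℝ) (v : ℝ) : Prop :=
  ∀ ε > 0, p - C v + C ε ∈ M ∧ C v - p + C ε ∈ M

theorem isNear_C (hM : IsProperQuadraticModule M) (v : ℝ) : IsNear M (C v) v := fun ε hε => by
  simpa using hM.C_mem hε.le

theorem IsNear.add {p q : MvPolynomial σ ℝ} {v w : ℝ} (hp : IsNear M p v) (hq : IsNear M q w) :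
    IsNear M (p + q) (v + w) := by
  intro ε hε
  have e : (C ε : MvPolynomial σ ℝ) = C (ε / 2) + C (ε / 2) := by rw [← map_add, add_halves]
  obtain ⟨h1, h2⟩ := hp (ε / 2) (half_pos hε)
  obtain ⟨h3, h4⟩ := hq (ε / 2) (half_pos hε)
  constructor
  · convert add_mem h1 h3 using 1
    rw [e, map_add]; ring
  · convert add_mem h2 h4 using 1
    rw [e, map_add]; ring

theorem IsNear.neg {p : MvPolynomial σ ℝ} {v : ℝ} (hp : IsNear M p v) : IsNear M (-p) (-v) := by
  intro ε hε
  obtain ⟨h1, h2⟩ := hp ε hε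
  constructor
  · convert h2 using 1
    rw [map_neg]; ring
  · convert h1 using 1
    rw [map_neg]; ring

theorem IsNear.C_mul (hM : IsProperQuadraticModule M) {p : MvPolynomial σ ℝ} {v : ℝ}
    (hp : IsNear M p v) (c : ℝ) : IsNear M (C c * p) (c * v) := by
  have key : ∀ c : ℝ, 0 < c → IsNear M (C c * p) (c * v) := by
    intro c hc ε hε
    have e : (C ε : MvPolynomial σ ℝ) = C c * C (ε / c) := by
      rw [← map_mul, mul_div_cancel₀ _ hc.ne']
    obtain ⟨h1, h2⟩ := hp (ε / c) (div_pos hε hc)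
    constructor
    · convert hM.C_mul_mem hc.le h1 using 1
      rw [e, map_mul]; ring
    · convert hM.C_mul_mem hc.le h2 using 1
      rw [e, map_mul]; ring
  rcases lt_trichotomy c 0 with h | rfl | h
  · simpa using (key (-c) (neg_pos.mpr h)).neg
  · simpa using isNear_C hM 0
  · exact key c h

theorem IsNear.sq_zero (hM : IsProperQuadraticModule M) {p : MvPolynomial σ ℝ}
    (hp : IsNear M p 0) : IsNear M (p ^ 2) 0 := by
  intro ε hε
  rw [map_zero, sub_zero, zero_sub]
  refine ⟨add_mem (hM.sos_mem (.sq p)) (hM.C_mem hε.le), ?_⟩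
  set δ := √ε
  have hδ : 0 < δ := Real.sqrt_pos.mpr hε
  have hδε : δ ^ 2 = ε := Real.sq_sqrt hε.le
  obtain ⟨h1, h2⟩ := hp δ hδ
  rw [map_zero, sub_zero] at h1
  rw [map_zero, zero_sub] at h2
  have h3 := hM.C_mul_mem (r := 1 / (2 * δ)) (by positivity)
    (add_mem (hM.sq_mul_mem (C δ + p) _ h2) (hM.sq_mul_mem (C δ - p) _ h1))
  convert h3 using 1
  have e : (C (1 / (2 * δ)) : MvPolynomial σ ℝ) * (2 * C δ) = 1 := by
    rw [show (2 : MvPolynomial σ ℝ) = C 2 from (map_ofNat C 2).symm, ← map_mul, ← map_mul, ← map_one C]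
    congr 1
    field_simp
  rw [← hδε, map_pow]
  linear_combination (-(C δ ^ 2 - p ^ 2)) * e

theorem IsNear.sq (hM : IsProperQuadraticModule M) {p : MvPolynomial σ ℝ} {v : ℝ}
    (hp : IsNear M p v) : IsNear M (p ^ 2) (v ^ 2) := by
  have h0 : IsNear M (p - C v) 0 := by
    simpa [sub_eq_add_neg] using hp.add (isNear_C hM v).neg
  convert (h0.sq_zero hM).add ((hp.C_mul hM (2 * v)).add (isNear_C hM (-v ^ 2))) using 1
  · simp only [map_mul, map_neg, map_pow, show (C 2 : MvPolynomial σ ℝ) = 2 from map_ofNat C 2]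
    ring
  · ring

theorem IsNear.mul (hM : IsProperQuadraticModule M) {p q : MvPolynomial σ ℝ} {v w : ℝ}
    (hp : IsNear M p v) (hq : IsNear M q w) : IsNear M (p * q) (v * w) := by
  have h := (((hp.add hq).sq hM).add ((hp.add hq.neg).sq hM).neg).C_mul hM (1 / 4)
  have h4 : (C (1 / 4) : MvPolynomial σ ℝ) * 4 = 1 := by
    rw [show (4 : MvPolynomial σ ℝ) = C 4 from (map_ofNat C 4).symm, ← map_mul]
    norm_num
  convert h using 1
  · linear_combination (-(p * q)) * h4
  · ring

theorem IsNear.nonneg (hM : IsProperQuadraticModule M) {p : MvPolynomial σ ℝ} {v : ℝ}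
    (hp : IsNear M p v) (hpM : p ∈ M) : 0 ≤ v := by
  by_contra! hv
  have h1 := (hp (-v / 2) (by linarith)).2
  have h2 := add_mem h1 hpM
  have e : C v - p + C (-v / 2) + p = C (v / 2) := by
    rw [sub_add_eq_add_sub, sub_add_cancel, ← map_add]
    congr 1
    ring
  rw [e] at h2
  exact hM.C_notMem (by linarith) h2

theorem exists_isNear (hM : Maximal IsProperQuadraticModule M) {p : MvPolynomial σ ℝ}
    (h₁ : ∃ N : ℝ, C N - p ∈ M) (h₂ : ∃ N : ℝ, C N + p ∈ M) : ∃ v, IsNear M p v := by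
  have hP := hM.prop
  obtain ⟨N₁, h₁⟩ := h₁
  obtain ⟨N₂, h₂⟩ := h₂
  set S : Set ℝ := {r | p - C r ∈ M}
  have hne : S.Nonempty := ⟨-N₂, by
    change p - C (-N₂) ∈ M
    rwa [map_neg, sub_neg_eq_add, add_comm]⟩
  have hbdd : BddAbove S := by
    refine ⟨N₁, fun r hr => ?_⟩
    by_contra! hlt
    have h := add_mem h₁ (show p - C r ∈ M from hr)
    rw [sub_add_sub_cancel, ← map_sub] at h
    exact hP.C_notMem (by linarith) h
  refine ⟨sSup S, fun ε hε => ⟨?_, ?_⟩⟩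
  · obtain ⟨r, hr, hlt⟩ := exists_lt_of_lt_csSup hne (sub_lt_self (sSup S) hε)
    have h := add_mem (show p - C r ∈ M from hr)
      (hP.C_mem (r := r - (sSup S - ε)) (by linarith))
    convert h using 1
    simp only [map_sub]
    ring
  · rcases mem_or_neg_mem hM (p - C (sSup S + ε)) with h | h
    · have := le_csSup hbdd (show sSup S + ε ∈ S from h)
      linarith
    · convert h using 1
      rw [map_add]; ring

theorem exists_bound {n : ℕ} {M : AddSubmonoid (MvPolynomial (Fin n) ℝ)}
    (hM : IsProperQuadraticModule M) {R : ℝ} (hR : 0 < R)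
    (hRM : C R - ∑ i : Fin n, X i ^ 2 ∈ M) (p : MvPolynomial (Fin n) ℝ) :
    ∃ N : ℝ, C N - p ∈ M := by
  have key : ∃ N : ℝ, 0 ≤ N ∧ C N - p ^ 2 ∈ M := by
    have h_mul : ∀ p q : MvPolynomial (Fin n) ℝ, (∃ N : ℝ, 0 ≤ N ∧ C N - p ^ 2 ∈ M) →
        (∃ N : ℝ, 0 ≤ N ∧ C N - q ^ 2 ∈ M) → ∃ N : ℝ, 0 ≤ N ∧ C N - (p * q) ^ 2 ∈ M := by
      rintro p q ⟨N₁, hN₁, h₁⟩ ⟨N₂, hN₂, h₂⟩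
      refine ⟨N₁ * N₂, mul_nonneg hN₁ hN₂, ?_⟩
      convert add_mem (hM.C_mul_mem hN₁ h₂) (hM.sq_mul_mem q _ h₁) using 1
      rw [map_mul]; ring
    induction p using MvPolynomial.induction_on with
    | C r => exact ⟨r ^ 2, sq_nonneg r, by simp⟩
    | add p q hp hq =>
      obtain ⟨N₁, hN₁, h₁⟩ := hp
      obtain ⟨N₂, hN₂, h₂⟩ := hq
      refine ⟨2 * (N₁ + N₂), by positivity, ?_⟩
      convert add_mem (add_mem (add_mem h₁ h₁) (add_mem h₂ h₂)) (hM.sos_mem (.sq (p - q))) using 1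
      rw [map_mul, map_add, show (C 2 : MvPolynomial (Fin n) ℝ) = 2 from map_ofNat C 2]
      ring
    | mul_X p i hp =>
      refine h_mul p (X i) hp ⟨R, hR.le, ?_⟩
      have h := add_mem hRM (sum_mem fun j (_ : j ∈ Finset.univ.erase i) =>
        hM.sos_mem (.sq (X j)))
      rw [← Finset.add_sum_erase _ _ (Finset.mem_univ i)] at h
      convert h using 1
      ring
  obtain ⟨N, -, h⟩ := key
  refine ⟨1 / 2 * (N + 1), ?_⟩
  convert hM.C_mul_mem (r := 1 / 2) (by norm_num) (add_mem h (hM.sos_mem (.sq (1 - p)))) using 1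
  have h2 : (C (1 / 2) : MvPolynomial (Fin n) ℝ) * 2 = 1 := by
    rw [show (2 : MvPolynomial (Fin n) ℝ) = C 2 from (map_ofNat C 2).symm, ← map_mul]
    norm_num
  rw [map_mul, map_add, map_one]
  linear_combination p * h2

end IsProperQuadraticModule

end Archimedean

open IsProperQuadraticModule in
/-- Certificate of emptiness in the Archimedean case. -/
theorem exists_inQM_eq_neg_one {n m : ℕ} (g : Fin m → MvPolynomial (Fin n) ℝ) (hg : ArchCond g)
    (f : MvPolynomial (Fin n) ℝ) (h : ∀ x ∈ Sg g, eval x f ≠ 0) :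
    ∃ p q, InQM g p ∧ p + q * f = -1 := by
  by_contra hne
  let M₀ : AddSubmonoid (MvPolynomial (Fin n) ℝ) :=
    { carrier := {a | ∃ p q, InQM g p ∧ p + q * f = a}
      add_mem' := by
        rintro _ _ ⟨p, q, hp, rfl⟩ ⟨p', q', hp', rfl⟩
        exact ⟨p + p', q + q', hp.add hp', by ring⟩
      zero_mem' := ⟨0, 0, .of_isSOS .zero, by simp⟩ }
  have hQ : ∀ p, InQM g p → p ∈ M₀ := fun p hp => ⟨p, 0, hp, by simp⟩
  have hf : ∀ q, q * f ∈ M₀ := fun q => ⟨0, q, .of_isSOS .zero, by simp⟩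
  have hM₀ : IsProperQuadraticModule M₀ := by
    refine ⟨hQ _ (.of_isSOS .one), ?_, hne⟩
    rintro a _ ⟨p, q, hp, rfl⟩
    exact ⟨a ^ 2 * p, a ^ 2 * q, hp.sos_mul (.sq a), by ring⟩
  obtain ⟨M, hle, hM⟩ := hM₀.exists_maximal
  obtain ⟨R, hR, hRg⟩ := hg
  have hbound := exists_bound hM.prop hR (hle (hQ _ hRg))
  choose x hx using fun i => exists_isNear hM (p := X i) (hbound _) (by
    simpa using hbound (-X i))
  have key : ∀ p, IsNear M p (eval x p) := by
    intro p
    induction p using MvPolynomial.induction_on with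
    | C r => simpa using isNear_C hM.prop r
    | add p q hp hq => simpa using hp.add hq
    | mul_X p i hp => simpa using hp.mul hM.prop (hx i)
  refine h x (fun j => (key _).nonneg hM.prop (hle (hQ _ (.generator j)))) (le_antisymm ?_ ?_)
  · have := (key (-f)).nonneg hM.prop (hle (by simpa using hf (-1)))
    simpa using this
  · exact (key f).nonneg hM.prop (hle (by simpa using hf 1))

section Derivations

/-- A formally smooth algebra admits ring-theoretic lifts along surjections with square-zero
kernel. -/
theorem exists_section_of_formallySmooth {R A B : Type*} [CommRing R] [CommRing A] [CommRing B]
    [Algebra R A] [Algebra.FormallySmooth R A] (φ : R →+* B) (π : B →+* A)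
    (hπ : Function.Surjective π) (hker : IsNilpotent (RingHom.ker π))
    (h : π.comp φ = algebraMap R A) :
    ∃ s : A →+* B, (∀ a, π (s a) = a) ∧ ∀ r, s (algebraMap R A r) = φ r := by
  let _ : Algebra R B := φ.toAlgebra
  let π' : B →ₐ[R] A := { π with commutes' := fun r => RingHom.congr_fun h r }
  refine ⟨(Algebra.FormallySmooth.liftOfSurjective (AlgHom.id R A) π' hπ hker : A →ₐ[R] B),
    fun a => ?_, fun r => ?_⟩
  · exact Algebra.FormallySmooth.liftOfSurjective_apply (AlgHom.id R A) π' hπ hker a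
  · exact AlgHom.commutes _ r

theorem formallySmooth_of_transcendental {F K : Type*} [Field F] [CharZero F] [Field K]
    [Algebra F[X] K] [FaithfulSMul F[X] K] : Algebra.FormallySmooth F[X] K := by
  let _ : Algebra (FractionRing F[X]) K := FractionRing.liftAlgebra F[X] K
  have h1 : Algebra.FormallySmooth F[X] (FractionRing F[X]) :=
    .of_isLocalization (nonZeroDivisors _)
  have h0 : CharZero (FractionRing F[X]) :=
    charZero_of_injective_algebraMap (R := F[X]) (IsFractionRing.injective _ _)
  obtain ⟨s, hs⟩ := exists_isTranscendenceBasis (FractionRing F[X]) K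
  have halg := hs.isAlgebraic_field
  have h2 : Algebra.FormallySmooth (FractionRing F[X]) K :=
    .of_algebraicIndependent_of_isSeparable hs.1
  exact .comp F[X] (FractionRing F[X]) K

/-- In characteristic zero, a transcendental element admits a derivation with value one. -/
theorem exists_derivation_eq_one {F K : Type*} [Field F] [CharZero F] [Field K] [Algebra F K]
    {θ : K} (hθ : Transcendental F θ) : ∃ D : Derivation F K K, D θ = 1 := by
  obtain ⟨s, hs, hsX⟩ : ∃ s : K →+* DualNumber K, (∀ a, (s a).fst = a) ∧
      ∀ p : F[X], s (Polynomial.aeval θ p) =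
        Polynomial.aeval (TrivSqZeroExt.inl θ + TrivSqZeroExt.inr 1 : DualNumber K) p := by
    let _ : Algebra F[X] K := (Polynomial.aeval θ).toRingHom.toAlgebra
    have : FaithfulSMul F[X] K := (faithfulSMul_iff_algebraMap_injective _ _).2
      (transcendental_iff_injective.1 hθ)
    have := formallySmooth_of_transcendental (F := F) (K := K)
    refine exists_section_of_formallySmooth (R := F[X])
      (Polynomial.aeval (TrivSqZeroExt.inl θ + TrivSqZeroExt.inr 1 : DualNumber K)).toRingHom
      (TrivSqZeroExt.fstHom F K K).toRingHom (fun a => ⟨TrivSqZeroExt.inl a, rfl⟩) ⟨2, ?_⟩ ?_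
    · rw [pow_two, Ideal.zero_eq_bot, eq_bot_iff, Ideal.mul_le]
      intro a ha b hb
      replace ha : a.fst = 0 := ha
      replace hb : b.fst = 0 := hb
      ext <;> simp [ha, hb]
    · change ((TrivSqZeroExt.fstHom F K K).comp (Polynomial.aeval
        (TrivSqZeroExt.inl θ + TrivSqZeroExt.inr 1 : DualNumber K))).toRingHom
          = (Polynomial.aeval θ).toRingHom
      congr 1
      ext
      simp
  refine ⟨Derivation.mk'
    { toFun := fun a => (s a).snd, map_add' := fun a b => by simp, map_smul' := fun c a => ?_}
      fun a b => ?_, ?_⟩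
  · have := hsX (Polynomial.C c)
    rw [Polynomial.aeval_C, Polynomial.aeval_C] at this
    rw [Algebra.smul_def, map_mul, this]
    have h1 : (algebraMap F (DualNumber K) c).fst = algebraMap F K c := rfl
    have h2 : (algebraMap F (DualNumber K) c).snd = 0 := rfl
    simp [h1, h2, Algebra.smul_def]
  · simp [hs, mul_comm]
  · have := hsX Polynomial.X
    rw [Polynomial.aeval_X, Polynomial.aeval_X] at this
    simp [this]

end Derivations

section CriticalValues

open Filter

theorem eval_polynomial_aeval {σ R : Type*} [CommSemiring R] (x : σ → R) (f : MvPolynomial σ R)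
    (P : Polynomial R) : eval x (Polynomial.aeval f P) = P.eval (eval x f) := by
  rw [← coe_aeval_eq_eval, RingHom.coe_coe, ← Polynomial.aeval_algHom_apply,
    Polynomial.coe_aeval_eq_eval]

theorem derivation_aeval_eq_sum {F K σ : Type*} [Fintype σ] [CommRing F] [CommRing K] [Algebra F K]
    (D : Derivation F K K) (x : σ → K) (p : MvPolynomial σ F) :
    D (aeval x p) = ∑ i, aeval x (pderiv i p) * D (x i) := by
  classical
  induction p using MvPolynomial.induction_on with
  | C a => simp
  | add p q hp hq => simp [hp, hq, add_mul, Finset.sum_add_distrib]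
  | mul_X p j hp =>
    simp only [map_mul, aeval_X, Derivation.leibniz, hp, smul_eq_mul, pderiv_X, map_add,
      add_mul, Finset.sum_add_distrib, Finset.mul_sum]
    congr 1
    · rw [Finset.sum_eq_single j]
      · simp
      · intro i _ hij
        simp [hij.symm]
      · simp
    · exact Finset.sum_congr rfl fun i _ => by ring

/-- At a Fritz John point over a field, any derivation kills the objective value unless
the multiplier of the objective vanishes. -/
theorem derivation_eq_zero_of_fritzJohn {F K σ ι : Type*} [Fintype σ] [Fintype ι] [CommRing F]
    [Field K] [Algebra F K] (D : Derivation F K K) (f : MvPolynomial σ F)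
    (g : ι → MvPolynomial σ F) (x : σ → K) (a : K) (b : ι → K) (ha : a ≠ 0)
    (hgrad : ∀ i, a * aeval x (pderiv i f) = ∑ j, b j * aeval x (pderiv i (g j)))
    (hcompl : ∀ j, b j * aeval x (g j) = 0) : D (aeval x f) = 0 := by
  have h : a * D (aeval x f) = ∑ j, b j * D (aeval x (g j)) := by
    simp only [derivation_aeval_eq_sum, Finset.mul_sum, ← mul_assoc, hgrad, Finset.sum_mul]
    exact Finset.sum_comm
  have h0 : ∑ j, b j * D (aeval x (g j)) = 0 := Finset.sum_eq_zero fun j _ => by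
    rcases mul_eq_zero.1 (hcompl j) with h | h <;> simp [h]
  exact (mul_eq_zero.1 (h.trans h0)).resolve_left ha

theorem finite_fritzJohn_values {n m : ℕ} (f : MvPolynomial (Fin n) ℝ)
    (g : Fin m → MvPolynomial (Fin n) ℝ) :
    {v : ℝ | ∃ p ∈ VFJ f g, p.2 0 ≠ 0 ∧ eval p.1 f = v}.Finite := by
  by_contra hinf
  let e := Set.Infinite.natEmbedding _ hinf
  choose p hp hp0 hpe using fun k => (e k).2
  have hinj : Function.Injective fun k => (e k : ℝ) := Subtype.val_injective.comp e.injective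
  let U := hyperfilter ℕ
  let κ : ℝ →+* Germ (U : Filter ℕ) ℝ :=
    (Germ.coeRingHom (U : Filter ℕ)).comp (RingHom.pi fun _ => RingHom.id ℝ)
  let _ : Algebra ℝ (Germ (U : Filter ℕ) ℝ) := κ.toAlgebra
  let x : Fin n → Germ (U : Filter ℕ) ℝ := fun i => ((fun k => (p k).1 i : ℕ → ℝ) : Germ _ ℝ)
  let μ : Fin (m + 1) → Germ (U : Filter ℕ) ℝ :=
    fun j => ((fun k => (p k).2 j : ℕ → ℝ) : Germ _ ℝ)
  have hx : ∀ h : MvPolynomial (Fin n) ℝ,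
      aeval x h = ((fun k => eval (p k).1 h : ℕ → ℝ) : Germ (U : Filter ℕ) ℝ) := fun h =>
    germ_eval₂ (U := U) (RingHom.id ℝ) (fun i k => (p k).1 i) h
  have htrans : Transcendental ℝ (aeval x f) := by
    rintro ⟨P, hP, hPf⟩
    have h1 : Polynomial.aeval (aeval x f) P
        = ((fun k => P.eval (e k : ℝ) : ℕ → ℝ) : Germ (U : Filter ℕ) ℝ) := by
      rw [Polynomial.aeval_algHom_apply, hx]
      congr 1
      funext k
      rw [← hpe, eval_polynomial_aeval]
    rw [h1] at hPf
    have h2 : ∀ᶠ k in (U : Filter ℕ), P.eval (e k : ℝ) = 0 := Germ.coe_eq.1 hPf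
    have h3 : {k | P.eval (e k : ℝ) = 0}.Finite :=
      (P.rootSet_finite ℝ |>.preimage hinj.injOn).subset fun k hk => by
        simpa [Polynomial.mem_rootSet, hP] using hk
    exact Filter.notMem_hyperfilter_of_finite h3 h2
  obtain ⟨D, hD⟩ := exists_derivation_eq_one htrans
  refine one_ne_zero (hD.symm.trans
    (derivation_eq_zero_of_fritzJohn D f g x (μ 0) (fun j => μ j.succ) ?_ ?_ ?_))
  · intro h
    have h2 : ∀ᶠ k in (U : Filter ℕ), (p k).2 0 = 0 := Germ.coe_eq.1 h
    obtain ⟨k, hk⟩ := h2.exists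
    exact hp0 k hk
  · intro i
    simp only [hx]
    have : ∑ j : Fin m, μ j.succ * ((fun k => eval (p k).1 (pderiv i (g j)) : ℕ → ℝ) :
        Germ (U : Filter ℕ) ℝ) = ((fun k => ∑ j, (p k).2 j.succ * eval (p k).1 (pderiv i (g j)) :
          ℕ → ℝ) : Germ (U : Filter ℕ) ℝ) := by
      have := map_sum (Germ.coeRingHom (R := ℝ) (U : Filter ℕ))
        (fun j k => (p k).2 (Fin.succ j) * eval (p k).1 (pderiv i (g j))) Finset.univ
      refine this.symm.trans ?_
      refine congrArg _ ?_
      ext k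
      simp
    rw [this]
    exact congrArg _ (funext fun k => (hp k).1 i)
  · intro j
    rw [hx]
    exact congrArg _ (funext fun k => (hp k).2.1 j)

end CriticalValues

section Interpolation

theorem exists_mem_eval_eq_const {σ : Type*} (M : MvPolynomial σ ℝ → Prop)
    (hsos : ∀ p, IsSOS p → M p) (hadd : ∀ p q, M p → M q → M (p + q))
    (hmul : ∀ p q, IsSOS p → M q → M (p * q)) (f : MvPolynomial σ ℝ) (v : ℝ)
    (hv : v < 0 → ∃ p q, M p ∧ p + q * (f - C v) = -1) :
    ∃ q, M q ∧ ∀ x, eval x f = v → eval x q = v := by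
  rcases lt_or_ge v 0 with h | h
  · obtain ⟨p, q, hp, hpq⟩ := hv h
    refine ⟨C ((v + 1) / 2) ^ 2 + C ((v - 1) / 2) ^ 2 * p,
      hadd _ _ (hsos _ (.sq _)) (hmul _ _ (.sq _) hp), fun x hx => ?_⟩
    have h1 : eval x p = -1 := by simpa [hx] using congrArg (eval x) hpq
    simp only [map_add, map_mul, map_pow, eval_C, h1]
    ring
  · refine ⟨C (√v) ^ 2, hsos _ (.sq _), fun x _ => ?_⟩
    simp [Real.sq_sqrt h]

/-- A cone containing the sums of squares contains a polynomial that agrees with `f` wherever `f`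
takes one of finitely many prescribed values, as soon as the negative values are certified
not to be attained. -/
theorem exists_mem_eval_eq {σ : Type*} (M : MvPolynomial σ ℝ → Prop)
    (hsos : ∀ p, IsSOS p → M p) (hadd : ∀ p q, M p → M q → M (p + q))
    (hmul : ∀ p q, IsSOS p → M q → M (p * q)) (f : MvPolynomial σ ℝ) (T : Finset ℝ)
    (hT : ∀ v, v < 0 → ∃ p q, M p ∧ p + q * (f - C v) = -1) :
    ∃ q, M q ∧ ∀ x, eval x f ∈ T → eval x q = eval x f := by
  choose Q hQ hQf using fun v => exists_mem_eval_eq_const M hsos hadd hmul f v (hT v)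
  refine ⟨∑ v ∈ T, Polynomial.aeval f (Lagrange.basis T id v) ^ 2 * Q v,
    Finset.sum_induction _ M hadd (hsos _ .zero) fun v _ => hmul _ _ (.sq _) (hQ v),
    fun x hx => ?_⟩
  simp only [map_sum, map_mul, map_pow, eval_polynomial_aeval]
  rw [Finset.sum_eq_single_of_mem _ hx]
  · have : (Lagrange.basis T id (eval x f)).eval (eval x f) = 1 :=
      Lagrange.eval_basis_self (v := id) Function.injective_id.injOn hx
    simpa [this] using hQf _ x rfl
  · intro v _ hvx
    have := Lagrange.eval_basis_of_ne (v := id) (s := T) hvx hx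
    rw [id] at this
    rw [this]
    simp

theorem eval_sub_C_ne_zero {n m : ℕ} {f : MvPolynomial (Fin n) ℝ}
    {g : Fin m → MvPolynomial (Fin n) ℝ} (hf : ∀ x ∈ Sg g, 0 ≤ eval x f) {v : ℝ} (hv : v < 0) :
    ∀ x ∈ Sg g, eval x (f - C v) ≠ 0 := fun x hx => by
  have := hf x hx
  simp only [map_sub, eval_C]
  linarith

theorem fritzJohn_identity {n m : ℕ} {f q : MvPolynomial (Fin n) ℝ}
    {g : Fin m → MvPolynomial (Fin n) ℝ}
    (hq : ∀ x, eval x f ∈ (finite_fritzJohn_values f g).toFinset → eval x q = eval x f) :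
    ∀ p ∈ VFJ f g, p.2 0 * eval (Sum.elim p.1 p.2)
      (rename Sum.inl f - rename Sum.inl q : MvPolynomial (Fin n ⊕ Fin (m + 1)) ℝ) = 0 := by
  intro p hp
  rcases eq_or_ne (p.2 0) 0 with h | h
  · simp [h]
  · have := hq p.1 (by simpa using ⟨p.1, p.2, hp, h, rfl⟩)
    rw [map_sub, eval_rename, eval_rename, Sum.elim_comp_inl, this, sub_self, mul_zero]

end Interpolation

/-- If `f` is non-negative on `S(g)`, then there is `q ∈ P(g)[x, λ̄]` such that
`λ₀ · (f − q)` vanishes on `V(h_FJ)`; under the Archimedean condition one can take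
`q ∈ Q(g)[x, λ̄]`. -/
theorem rep_FJ_with_denominator {n m : ℕ} (f : MvPolynomial (Fin n) ℝ)
    (g : Fin m → MvPolynomial (Fin n) ℝ)
    (hf : ∀ x ∈ Sg g, 0 ≤ eval x f) :
    (∃ q : MvPolynomial (Fin n ⊕ Fin (m + 1)) ℝ,
      InPre (fun j => rename Sum.inl (g j)) q ∧
      ∀ p ∈ VFJ f g, p.2 0 * eval (Sum.elim p.1 p.2) (rename Sum.inl f - q) = 0) ∧
    (ArchCond g → ∃ q : MvPolynomial (Fin n ⊕ Fin (m + 1)) ℝ,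
      InQM (fun j => rename Sum.inl (g j)) q ∧
      ∀ p ∈ VFJ f g, p.2 0 * eval (Sum.elim p.1 p.2) (rename Sum.inl f - q) = 0) := by
  constructor
  · obtain ⟨q, hq, hqf⟩ := exists_mem_eval_eq (InPre g) (fun _ => .of_isSOS)
      (fun _ _ => .add) (fun _ _ => .sos_mul) f (finite_fritzJohn_values f g).toFinset
      fun v hv => exists_inPre_eq_neg_one g _ (eval_sub_C_ne_zero hf hv)
    exact ⟨rename Sum.inl q, hq.map (rename Sum.inl).toRingHom, fritzJohn_identity hqf⟩
  · intro hg
    obtain ⟨q, hq, hqf⟩ := exists_mem_eval_eq (InQM g) (fun _ => .of_isSOS)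
      (fun _ _ => .add) (fun _ _ => .sos_mul) f (finite_fritzJohn_values f g).toFinset
      fun v hv => exists_inQM_eq_neg_one g hg _ (eval_sub_C_ne_zero hf hv)
    exact ⟨rename Sum.inl q, hq.map (rename Sum.inl).toRingHom, fritzJohn_identity hqf⟩
end
end

section
/- Let f, g_1, …, g_m ∈ ℝ[x] with g = (g_1,…,g_m). Then the set {f(x) : (x, λ̄) ∈ V(h_FJ) and λ_0 ≠ 0}, i.e. the image under f of the projection of V(h_FJ) \ {λ_0 = 0} to the x-coordinates, is a finite set. -/
open MvPolynomial

noncomputable section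

theorem MvPolynomial.derivation_aeval {k A M σ : Type*} [CommRing k] [CommRing A] [Algebra k A]
    [AddCommGroup M] [Module k M] [Module A M] [Fintype σ]
    (D : Derivation k A M) (x : σ → A) (p : MvPolynomial σ k) :
    D (aeval x p) = ∑ i, aeval x (pderiv i p) • D (x i) := by
  classical
  induction p using MvPolynomial.induction_on with
  | C a => simp
  | add p q hp hq => simp [hp, hq, add_smul, Finset.sum_add_distrib]
  | mul_X p i hp =>
    simp [hp, pderiv_X, Pi.single_apply, add_smul, Finset.sum_add_distrib, Finset.smul_sum,
      mul_smul, apply_ite (aeval x), ite_smul]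

open Polynomial TensorProduct in
/-- In a finitely generated field extension of characteristic zero, an element with vanishing
Kähler differential is algebraic over the base field. -/
theorem isAlgebraic_of_kaehlerDifferential_D_eq_zero {k K : Type*} [Field k] [CharZero k] [Field K]
    [Algebra k K] [Algebra.EssFiniteType k K] {t : K} (ht : KaehlerDifferential.D k K t = 0) :
    IsAlgebraic k t := by
  by_contra htr
  have hinj : Function.Injective (Polynomial.aeval t : k[X] →ₐ[k] K) :=
    transcendental_iff_injective.mp htr
  let : Algebra k[X] K := (Polynomial.aeval t : k[X] →ₐ[k] K).toAlgebra
  have : IsScalarTower k k[X] K := .of_algHom (Polynomial.aeval t)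
  have : FaithfulSMul k[X] K := (faithfulSMul_iff_algebraMap_injective _ _).mpr hinj
  let F := FractionRing k[X]
  let : Algebra F K := FractionRing.liftAlgebra k[X] K
  have : IsScalarTower k[X] F K := FractionRing.isScalarTower_liftAlgebra _ _
  have : IsScalarTower k F K := .to₁₃₄ k k[X] F K
  have : CharZero F := charZero_of_injective_algebraMap (algebraMap k F).injective
  have : Algebra.EssFiniteType F K := .of_comp k F K
  have : Algebra.FormallySmooth k[X] F := .of_isLocalization (nonZeroDivisors k[X])
  have : Algebra.FormallySmooth k[X] K := .comp _ F _
  have hzero : KaehlerDifferential.mapBaseChange k k[X] K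
      (1 ⊗ₜ KaehlerDifferential.D k k[X] X) = 0 := by
    have hX : algebraMap k[X] K X = t := Polynomial.aeval_X t
    simp [hX, ht]
  obtain ⟨y, hy⟩ := (Algebra.H1Cotangent.exact_δ_mapBaseChange k k[X] K _).mp hzero
  rw [Subsingleton.elim y 0, map_zero] at hy
  have h := congrArg
    ((TensorProduct.rid k[X] K).toLinearMap ∘ₗ
      ((KaehlerDifferential.polynomialEquiv k).toLinearMap.lTensor K)) hy
  simp at h

/-- The critical value of a Fritz John point over a field is algebraic over the base field. -/
theorem isAlgebraic_aeval_of_isCritical {k K σ ι : Type*} [Field k] [CharZero k] [Field K]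
    [Algebra k K] [Algebra.EssFiniteType k K] [Fintype σ] [Fintype ι] (f : MvPolynomial σ k)
    (g : ι → MvPolynomial σ k) (x : σ → K) (μ : ι → K)
    (hgrad : ∀ i, aeval x (pderiv i f) = ∑ j, μ j * aeval x (pderiv i (g j)))
    (hcompl : ∀ j, μ j * aeval x (g j) = 0) : IsAlgebraic k (aeval x f) := by
  apply isAlgebraic_of_kaehlerDifferential_D_eq_zero
  have hD : KaehlerDifferential.D k K (aeval x f)
      = ∑ j, μ j • KaehlerDifferential.D k K (aeval x (g j)) := by
    simp_rw [derivation_aeval, hgrad, Finset.sum_smul, Finset.smul_sum, mul_smul]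
    exact Finset.sum_comm
  rw [hD]
  refine Finset.sum_eq_zero fun j _ ↦ ?_
  rcases mul_eq_zero.mp (hcompl j) with h | h <;> simp [h]

/-- The values of `f` at the points admitting normalized Lagrange multipliers are finitely many. -/
theorem finite_criticalValues {k σ ι : Type*} [Field k] [CharZero k] [Fintype σ] [Fintype ι]
    (f : MvPolynomial σ k) (g : ι → MvPolynomial σ k) :
    {c | ∃ (x : σ → k) (μ : ι → k), (∀ i, eval x (pderiv i f) = ∑ j, μ j * eval x (pderiv i (g j)))
      ∧ (∀ j, μ j * eval x (g j) = 0) ∧ eval x f = c}.Finite := by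
  let R := MvPolynomial (σ ⊕ ι) k
  let ξ : σ → R := fun i ↦ X (.inl i)
  let I : Ideal R := Ideal.span
    (Set.range (fun i ↦ aeval ξ (pderiv i f) - ∑ j, X (.inr j) * aeval ξ (pderiv i (g j))) ∪
      Set.range (fun j ↦ X (.inr j) * aeval ξ (g j)))
  have hmin (P : Ideal R) (hP : P ∈ I.minimalPrimes) :
      ∃ q : Polynomial k, q ≠ 0 ∧ Polynomial.aeval (aeval ξ f) q ∈ P := by
    have : P.IsPrime := hP.1.1
    let K := P.ResidueField
    let φ : R →ₐ[k] K := IsScalarTower.toAlgHom k R K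
    have hφ (p : MvPolynomial σ k) : aeval (fun i ↦ φ (ξ i)) p = φ (aeval ξ p) := by
      rw [← comp_aeval_apply]
    have hI {r : R} (hr : r ∈ I) : φ r = 0 := Ideal.algebraMap_residueField_eq_zero.mpr (hP.1.2 hr)
    have : Algebra.EssFiniteType k K := .comp k R K
    obtain ⟨q, hq0, hq⟩ := isAlgebraic_aeval_of_isCritical f g (fun i ↦ φ (ξ i))
      (fun j ↦ φ (X (.inr j)))
      (fun i ↦ by
        have := hI (Ideal.subset_span (Or.inl ⟨i, rfl⟩))
        simpa only [hφ, map_sub, map_sum, map_mul, sub_eq_zero] using this)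
      (fun j ↦ by
        have := hI (Ideal.subset_span (Or.inr ⟨j, rfl⟩))
        simpa only [hφ, map_mul] using this)
    refine ⟨q, hq0, Ideal.algebraMap_residueField_eq_zero.mp ?_⟩
    rw [hφ, Polynomial.aeval_algHom_apply] at hq
    exact hq
  choose! q hq0 hq using hmin
  refine ((Ideal.finite_minimalPrimes_of_isNoetherianRing R I).biUnion
    fun P hP ↦ (q P).rootSet_finite k).subset ?_
  rintro c ⟨x, μ, hgrad, hcompl, rfl⟩
  let ψ : R →ₐ[k] k := aeval (Sum.elim x μ)
  have hψ (p : MvPolynomial σ k) : ψ (aeval ξ p) = eval x p := by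
    rw [comp_aeval_apply]
    have hx : (fun i ↦ ψ (ξ i)) = x := funext fun i ↦ aeval_X _ (Sum.inl i)
    rw [hx, aeval_eq_eval]
  have hψμ (j : ι) : ψ (X (.inr j)) = μ j := aeval_X _ (Sum.inr j)
  have hle : I ≤ RingHom.ker ψ := by
    rw [Ideal.span_le, Set.union_subset_iff]
    constructor
    · rintro _ ⟨i, rfl⟩
      simp [hψ, hψμ, hgrad]
    · rintro _ ⟨j, rfl⟩
      simpa [hψ, hψμ] using hcompl j
  have : (RingHom.ker ψ).IsPrime := RingHom.ker_isPrime ψ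
  obtain ⟨P, hP, hPle⟩ := Ideal.exists_minimalPrimes_le hle
  refine Set.mem_biUnion hP ((Polynomial.mem_rootSet).mpr ⟨hq0 P hP, ?_⟩)
  rw [← hψ, Polynomial.aeval_algHom_apply]
  exact hPle (hq P hP)

/-- The image under `f` of the part of `V(h_FJ)` outside the hyperplane `λ₀ = 0`
(projected to the `x`-coordinates) is a finite set. -/
theorem finite_image_VFJ_off_hyperplane {n m : ℕ} (f : MvPolynomial (Fin n) ℝ)
    (g : Fin m → MvPolynomial (Fin n) ℝ) :
    ((fun p : (Fin n → ℝ) × (Fin (m + 1) → ℝ) => eval p.1 f) ''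
      {p | p ∈ VFJ f g ∧ p.2 0 ≠ 0}).Finite := by
  refine (finite_criticalValues f g).subset ?_
  rintro _ ⟨⟨x, l⟩, ⟨⟨hgrad, hcompl, -⟩, h0⟩, rfl⟩
  dsimp only at hgrad hcompl h0
  refine ⟨x, fun j ↦ l j.succ / l 0, fun i ↦ ?_, fun j ↦ ?_, rfl⟩
  · rw [← mul_right_inj' h0, hgrad, Finset.mul_sum]
    exact Finset.sum_congr rfl fun j _ ↦ by field_simp
  · rw [div_mul_eq_mul_div, hcompl, zero_div]
end
end
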